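/- arXiv:2102.12977 — 2 statements merged into one kernel-verified Lean document; each statement's English description precedes it below -/
import Mathlib

section
/- Let p be a prime number with p ≡ 25 (mod 48) such that there is no z ∈ 𝔽_p with z⁴ = 2 and no w ∈ 𝔽_p with w⁴ − 2w² − 2 = 0 (equivalently: p splits completely in neither ℚ(2^{1/4}) nor ℚ(√(1+√3))). Then every rational solution (x, y) ∈ ℚ × ℚ of y² = x(x² − p²)(x² − 4p²) satisfies y = 0 (hence x ∈ {0, p, −p, 2p, −2p}). -/
/-- A nonnegative integer that is a factor of a square, prime to the cofactor, is a square. -/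
theorem Int.exists_eq_sq_of_isCoprime {a b c : ℤ} (ha : 0 ≤ a) (h : IsCoprime a b)
    (e : a * b = c ^ 2) : ∃ d, a = d ^ 2 := by
  obtain ⟨d, hd | hd⟩ := Int.sq_of_gcd_eq_one (Int.isCoprime_iff_gcd_eq_one.1 h) e
  · exact ⟨d, hd⟩
  · exact ⟨0, by nlinarith [sq_nonneg d]⟩

theorem Int.sq_or_neg_sq_of_isCoprime {a b c : ℤ} (h : IsCoprime a b) (hc : c ≠ 0)
    (e : c ^ 2 = a * b) :
    ∃ x y, x ≠ 0 ∧ y ≠ 0 ∧ (a = x ^ 2 ∧ b = y ^ 2 ∨ a = -x ^ 2 ∧ b = -y ^ 2) := by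
  have hc2 : 0 < c ^ 2 := by positivity
  rcases lt_trichotomy a 0 with ha | ha | ha
  · have hb : b < 0 := by nlinarith
    obtain ⟨x, hx⟩ := exists_eq_sq_of_isCoprime (by omega) h.neg_neg (c := c) (by linarith)
    obtain ⟨y, hy⟩ := exists_eq_sq_of_isCoprime (by omega) h.symm.neg_neg (c := c) (by linarith)
    refine ⟨x, y, ?_, ?_, Or.inr ⟨by linarith, by linarith⟩⟩ <;> rintro rfl <;> omega
  · simp [ha, hc] at e
  · have hb : 0 < b := by nlinarith
    obtain ⟨x, hx⟩ := exists_eq_sq_of_isCoprime ha.le h (c := c) (by linarith)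
    obtain ⟨y, hy⟩ := exists_eq_sq_of_isCoprime hb.le h.symm (c := c) (by linarith)
    refine ⟨x, y, ?_, ?_, Or.inl ⟨hx, hy⟩⟩ <;> rintro rfl <;> omega

/-- A prime factor (or `1`) of a product divides one of the two factors. -/
theorem Int.exists_eq_mul_of_mul_eq {q U V W : ℤ} (hq : q = 1 ∨ Prime q) (h : U * V = q * W) :
    (∃ X, U = q * X ∧ X * V = W) ∨ ∃ X, V = q * X ∧ U * X = W := by
  rcases hq with rfl | hq
  · exact Or.inl ⟨U, by ring, by linarith⟩
  · rcases hq.dvd_or_dvd ⟨W, h⟩ with ⟨X, rfl⟩ | ⟨X, rfl⟩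
    · exact Or.inl ⟨X, rfl, mul_left_cancel₀ hq.ne_zero (by linarith)⟩
    · exact Or.inr ⟨X, rfl, mul_left_cancel₀ hq.ne_zero (by linarith)⟩

/-- Parametrization of the coprime solutions of `n² = m² + q k²` with `k` even. -/
theorem Int.param_sq_add_mul_sq {q m k n : ℤ} (hq : q = 1 ∨ Prime q) (hq0 : 0 < q)
    (h : n ^ 2 = m ^ 2 + q * k ^ 2) (hk : Even k) (hc : IsCoprime m k) :
    ∃ u v, m ^ 2 = (u ^ 2 - q * v ^ 2) ^ 2 ∧ k ^ 2 = 4 * u ^ 2 * v ^ 2 ∧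
      n ^ 2 = (u ^ 2 + q * v ^ 2) ^ 2 ∧ IsCoprime u (q * v) := by
  wlog hn : 0 ≤ n generalizing n
  · obtain ⟨u, v, h1, h2, h3, h4⟩ := this (n := -n) (by linarith [neg_sq n]) (by omega)
    exact ⟨u, v, h1, h2, by linarith [neg_sq n], h4⟩
  obtain ⟨j, rfl⟩ := hk
  have hpar : (2 : ℤ) ∣ n - m := by
    have : (2 : ℤ) ∣ (n - m) * (n + m) := ⟨q * j ^ 2 * 2, by linarith⟩
    rcases Int.prime_two.dvd_or_dvd this with h | h <;> omega
  obtain ⟨X, hX⟩ := hpar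
  have hXY : X * (X + m) = q * j ^ 2 := by
    have : n = m + 2 * X := by linarith
    subst this; linarith
  have hsq : Squarefree q := by
    rcases hq with rfl | hq
    · exact squarefree_one
    · exact hq.irreducible.squarefree
  have hcop : IsCoprime X (X + m) := by
    refine isCoprime_of_prime_dvd ?_ ?_
    · rintro ⟨rfl, h0⟩
      have hm : m = 0 := by linarith
      subst hm
      have := isCoprime_zero_left.1 hc
      rw [Int.isUnit_iff] at this
      omega
    · intro r hr h1 h2
      have hm : r ∣ m := by simpa using dvd_sub h2 h1
      have hd : r * r ∣ q * j ^ 2 := hXY ▸ mul_dvd_mul h1 h2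
      have hrj : IsCoprime r j :=
        (hc.of_isCoprime_of_dvd_left hm).of_isCoprime_of_dvd_right ⟨2, by ring⟩
      have : IsCoprime (r * r) (j ^ 2) := (hrj.mul_left hrj).pow_right
      exact hr.not_isUnit (hsq r (this.dvd_of_dvd_mul_right hd))
  have hnn : 0 ≤ q * j ^ 2 := by positivity
  have hX0 : 0 ≤ X ∧ 0 ≤ X + m := by
    constructor <;> by_contra hneg <;> push Not at hneg <;> nlinarith
  have key : ∀ M Z Y : ℤ, M ^ 2 = m ^ 2 → Y = q * Z + M → n = q * Z + Y → Z * Y = j ^ 2 → 0 ≤ Y →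
      IsCoprime (q * Z) Y → ∃ u v, m ^ 2 = (u ^ 2 - q * v ^ 2) ^ 2 ∧
        (j + j) ^ 2 = 4 * u ^ 2 * v ^ 2 ∧ n ^ 2 = (u ^ 2 + q * v ^ 2) ^ 2 ∧
        IsCoprime u (q * v) := by
    intro M Z Y hM hY hnY hZY hY0 hco
    have hZ0 : 0 ≤ Z := by
      by_contra hneg
      have : Y ≠ 0 := by
        rintro rfl
        have hj : j = 0 := by simpa using hZY.symm
        subst hj
        have hm1 := Int.isUnit_iff.1 (isCoprime_zero_right.1 (by simpa using hc))
        have hn1 : n ^ 2 = 1 := by rcases hm1 with rfl | rfl <;> linarith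
        nlinarith
      have : 0 < Y := by omega
      nlinarith [sq_nonneg j]
    have hcZ : IsCoprime Z Y := hco.of_mul_left_right
    obtain ⟨v, rfl⟩ := exists_eq_sq_of_isCoprime hZ0 hcZ hZY
    obtain ⟨u, rfl⟩ := exists_eq_sq_of_isCoprime hY0 hcZ.symm (by rw [mul_comm]; exact hZY)
    refine ⟨u, v, ?_, ?_, ?_, ?_⟩
    · rw [← hM, hY]; ring
    · linear_combination (-4) * hZY
    · rw [hnY]; ring
    · have h1 : IsCoprime (u ^ 2) (q * v * v) := by
        convert hco.symm using 1; ring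
      exact ((IsCoprime.pow_left_iff two_pos).1 h1).of_mul_right_left
  rcases exists_eq_mul_of_mul_eq hq hXY with ⟨Z, rfl, hZ⟩ | ⟨Z, hZ', hZ⟩
  · exact key m Z (q * Z + m) rfl rfl (by linarith) hZ hX0.2 hcop
  · exact key (-m) Z X (by ring) (by linarith) (by linarith) (by linarith) hX0.1
      (hZ' ▸ hcop.symm)

theorem Int.factor_sq_mul_pow_four {c e U V : ℤ} (hc : c = 1 ∨ Prime c) (hc0 : 0 < c)
    (hU : 0 < U) (hV : 0 < V) (hUV : IsCoprime U V) (h : U * V = c ^ 2 * e ^ 4) :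
    ∃ g h, e ^ 2 = g ^ 2 * h ^ 2 ∧ IsCoprime (c * g) h ∧
      (U = c ^ 2 * g ^ 4 ∧ V = h ^ 4 ∨ U = h ^ 4 ∧ V = c ^ 2 * g ^ 4) := by
  have h' : U * V = (c * e ^ 2) ^ 2 := by rw [h]; ring
  obtain ⟨A, rfl⟩ := exists_eq_sq_of_isCoprime hU.le hUV h'
  obtain ⟨B, rfl⟩ := exists_eq_sq_of_isCoprime hV.le hUV.symm (by rw [mul_comm]; exact h')
  wlog hA : 0 ≤ A generalizing A
  · simpa using this (-A) (by simpa) (by simpa) (by simpa) (by simpa) (by omega)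
  wlog hB : 0 ≤ B generalizing B
  · simpa using this (-B) (by simpa) (by simpa) (by simpa) (by simpa) (by omega)
  have hAB : IsCoprime A B := (IsCoprime.pow_iff two_pos two_pos).1 hUV
  have hprod : A * B = c * e ^ 2 := by
    refine (pow_left_inj₀ (by positivity) (by positivity) two_ne_zero).1 ?_
    rw [← h']; ring
  have hA0 : 0 < A := lt_of_le_of_ne hA (by rintro rfl; simp at hU)
  have hB0 : 0 < B := lt_of_le_of_ne hB (by rintro rfl; simp at hV)
  rcases exists_eq_mul_of_mul_eq hc hprod with ⟨Z, rfl, hZ⟩ | ⟨Z, rfl, hZ⟩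
  · have hZ0 : 0 ≤ Z := by nlinarith
    have hZB := hAB.of_mul_left_right
    obtain ⟨g, rfl⟩ := exists_eq_sq_of_isCoprime hZ0 hZB hZ
    obtain ⟨k, rfl⟩ := exists_eq_sq_of_isCoprime hB hZB.symm (by rw [mul_comm]; exact hZ)
    refine ⟨g, k, hZ.symm, ?_, Or.inl ⟨by ring, by ring⟩⟩
    have h1 := (IsCoprime.pow_right_iff two_pos).1 hAB
    rw [pow_two, ← mul_assoc] at h1
    exact h1.of_mul_left_left
  · have hZ0 : 0 ≤ Z := by nlinarith
    have hZB := hAB.symm.of_mul_left_right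
    obtain ⟨g, rfl⟩ := exists_eq_sq_of_isCoprime hZ0 hZB (by rw [mul_comm]; exact hZ)
    obtain ⟨k, rfl⟩ := exists_eq_sq_of_isCoprime hA hZB.symm hZ
    refine ⟨g, k, by linarith, ?_, Or.inr ⟨by ring, by ring⟩⟩
    have h1 := (IsCoprime.pow_right_iff two_pos).1 hAB.symm
    rw [pow_two, ← mul_assoc] at h1
    exact h1.of_mul_left_left

theorem Int.factor_six_mul_sq_mul_pow_four {c e U V : ℤ} (hc : c = 1 ∨ Prime c) (hc0 : 0 < c)
    (hU : 0 < U) (hV : 0 < V) (hUV : IsCoprime U V) (h : U * V = 6 * (c ^ 2 * e ^ 4)) :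
    ∃ g h, e ^ 2 = g ^ 2 * h ^ 2 ∧ IsCoprime (c * g) h ∧
      (U + V = 6 * c ^ 2 * g ^ 4 + h ^ 4 ∨ U + V = c ^ 2 * g ^ 4 + 6 * h ^ 4 ∨
        U + V = 2 * c ^ 2 * g ^ 4 + 3 * h ^ 4 ∨ U + V = 3 * c ^ 2 * g ^ 4 + 2 * h ^ 4) := by
  have h2 : U * V = 2 * (3 * (c ^ 2 * e ^ 4)) := by rw [h]; ring
  have p2 : (2 : ℤ) = 1 ∨ Prime (2 : ℤ) := Or.inr Int.prime_two
  have p3 : (3 : ℤ) = 1 ∨ Prime (3 : ℤ) := Or.inr Int.prime_three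
  rcases exists_eq_mul_of_mul_eq p2 h2 with ⟨X, rfl, hX⟩ | ⟨X, rfl, hX⟩
  · replace hUV := hUV.of_mul_left_right
    rcases exists_eq_mul_of_mul_eq p3 hX with ⟨Y, rfl, hY⟩ | ⟨Y, rfl, hY⟩
    · obtain ⟨g, k, h1, hgk, ⟨rfl, rfl⟩ | ⟨rfl, rfl⟩⟩ := factor_sq_mul_pow_four hc hc0 (by omega) hV
        hUV.of_mul_left_right hY
      · exact ⟨g, k, h1, hgk, Or.inl (by ring)⟩
      · exact ⟨g, k, h1, hgk, Or.inr (Or.inl (by ring))⟩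
    · obtain ⟨g, k, h1, hgk, ⟨rfl, rfl⟩ | ⟨rfl, rfl⟩⟩ := factor_sq_mul_pow_four hc hc0 (by omega)
        (by omega) hUV.of_mul_right_right hY
      · exact ⟨g, k, h1, hgk, Or.inr (Or.inr (Or.inl (by ring)))⟩
      · exact ⟨g, k, h1, hgk, Or.inr (Or.inr (Or.inr (by ring)))⟩
  · replace hUV := hUV.of_mul_right_right
    rcases exists_eq_mul_of_mul_eq p3 hX with ⟨Y, rfl, hY⟩ | ⟨Y, rfl, hY⟩
    · obtain ⟨g, k, h1, hgk, ⟨rfl, rfl⟩ | ⟨rfl, rfl⟩⟩ := factor_sq_mul_pow_four hc hc0 (by omega)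
        (by omega) hUV.of_mul_left_right hY
      · exact ⟨g, k, h1, hgk, Or.inr (Or.inr (Or.inr (by ring)))⟩
      · exact ⟨g, k, h1, hgk, Or.inr (Or.inr (Or.inl (by ring)))⟩
    · obtain ⟨g, k, h1, hgk, ⟨rfl, rfl⟩ | ⟨rfl, rfl⟩⟩ := factor_sq_mul_pow_four hc hc0 (by omega)
        (by omega) hUV.of_mul_right_right hY
      · exact ⟨g, k, h1, hgk, Or.inr (Or.inl (by ring))⟩
      · exact ⟨g, k, h1, hgk, Or.inl (by ring)⟩

theorem Int.abs_eq_of_sq_eq_add {c e f t s n : ℤ} (hc : c = 1 ∨ Prime c) (hc0 : 0 < c)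
    (he : e ≠ 0) (hs : s = f ^ 2 + t * (c * e ^ 2)) (hco : IsCoprime f (c * e))
    (h : s ^ 2 = n ^ 2 + 24 * c ^ 2 * e ^ 4) :
    ∃ g h, e ^ 2 = g ^ 2 * h ^ 2 ∧ IsCoprime (c * g) h ∧
      (|s| = 6 * c ^ 2 * g ^ 4 + h ^ 4 ∨ |s| = c ^ 2 * g ^ 4 + 6 * h ^ 4 ∨
        |s| = 2 * c ^ 2 * g ^ 4 + 3 * h ^ 4 ∨ |s| = 3 * c ^ 2 * g ^ 4 + 2 * h ^ 4) := by
  have hpos : 0 < c ^ 2 * e ^ 4 := by positivity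
  have hr : ∀ r, Prime r → r ∣ |s| → IsCoprime r (c * e) := by
    intro r hr hrs
    rw [dvd_abs] at hrs
    refine (Irreducible.coprime_iff_not_dvd hr.irreducible).2 fun hd => ?_
    have h1 : r ∣ f ^ 2 := by
      have : f ^ 2 = s - t * e * (c * e) := by rw [hs]; ring
      rw [this]
      exact dvd_sub hrs (hd.mul_left _)
    exact hr.not_isUnit (hco.isUnit_of_dvd' (hr.dvd_of_dvd_pow h1) hd)
  have habs : |s| ^ 2 = |n| ^ 2 + 24 * (c ^ 2 * e ^ 4) := by rw [sq_abs, sq_abs, h]; ring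
  have hs0 := abs_nonneg s
  have hn0 := abs_nonneg n
  generalize |s| = S at *
  generalize |n| = N at *
  have hpar : (2 : ℤ) ∣ S - N := by
    have : (2 : ℤ) ∣ (S - N) * (S + N) := ⟨12 * (c ^ 2 * e ^ 4), by linarith⟩
    rcases Int.prime_two.dvd_or_dvd this with h | h <;> omega
  obtain ⟨U, hU⟩ := hpar
  obtain rfl : S = N + 2 * U := by linarith
  have hUV : U * (N + U) = 6 * (c ^ 2 * e ^ 4) := by linarith
  have hU0 : 0 < U := by
    by_contra hneg
    push Not at hneg
    nlinarith
  have hcop : IsCoprime U (N + U) := by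
    refine isCoprime_of_prime_dvd (by rintro ⟨h1, -⟩; omega) fun r hrp h1 h2 => ?_
    have h3 := hr r hrp (by
      have : N + 2 * U = U + (N + U) := by ring
      rw [this]; exact dvd_add h1 h2)
    have h4 : r * r ∣ 6 * (c ^ 2 * e ^ 4) := hUV ▸ mul_dvd_mul h1 h2
    have h5 : IsCoprime r (c ^ 2 * e ^ 4) :=
      (IsCoprime.of_mul_right_left h3).pow_right.mul_right
        (IsCoprime.of_mul_right_right h3).pow_right
    have h6 : r * r ∣ 6 := (h5.mul_left h5).dvd_of_dvd_mul_right h4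
    have hle := Int.le_of_dvd (by norm_num) h6
    have hr1 : -2 ≤ r := by nlinarith
    have hr2 : r ≤ 2 := by nlinarith
    have h0 := hrp.ne_zero
    have hu := hrp.not_isUnit
    rw [Int.isUnit_iff] at hu
    clear h1 h2 h3 h5 hrp hr
    interval_cases r <;> revert h0 hu h6 <;> norm_num
  obtain ⟨g, k, h1, h2, h3⟩ := factor_six_mul_sq_mul_pow_four hc hc0 hU0 (by omega) hcop hUV
  have : U + (N + U) = N + 2 * U := by ring
  rw [this] at h3
  exact ⟨g, k, h1, h2, h3⟩

theorem IsCoprime.of_lin_comb {R : Type*} [CommRing R] {a b x y : R} (h : IsCoprime a b)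
    (α β γ δ : R) (ha : a = α * x + β * y) (hb : b = γ * x + δ * y) : IsCoprime x y := by
  obtain ⟨s, t, hst⟩ := h
  exact ⟨s * α + t * γ, s * β + t * δ, by rw [← hst, ha, hb]; ring⟩

theorem Int.even_of_forall_zmod_four {k : ℤ} (h : 2 * (k : ZMod 4) = 0) : Even k := by
  have : ((2 * k : ℤ) : ZMod 4) = 0 := by push_cast; exact h
  have := (ZMod.intCast_zmod_eq_zero_iff_dvd _ _).1 this
  rw [Int.even_iff]
  push_cast at this
  omega

theorem Int.not_isCoprime_of_zmod_three {g h : ℤ} (hg : (g : ZMod 3) = 0)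
    (hh : (h : ZMod 3) = 0) : ¬ IsCoprime g h := by
  intro hc
  have hg := (ZMod.intCast_zmod_eq_zero_iff_dvd g 3).1 hg
  have hh := (ZMod.intCast_zmod_eq_zero_iff_dvd h 3).1 hh
  have := hc.isUnit_of_dvd' hg hh
  rw [Int.isUnit_iff] at this
  norm_num at this

theorem Int.zmod_three_eq_one {c : ℤ} (hc : c % 24 = 1) : (c : ZMod 3) = 1 := by
  have := (ZMod.intCast_eq_intCast_iff_dvd_sub 1 c 3).2 (by omega)
  rw [← this]; simp

theorem Int.zmod_four_eq_one {c : ℤ} (hc : c % 24 = 1) : (c : ZMod 4) = 1 := by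
  have := (ZMod.intCast_eq_intCast_iff_dvd_sub 1 c 4).2 (by omega)
  rw [← this]; simp

/-- Two-descent step for `m² + c k² = □`, `m² + 3 c k² = □`. -/
theorem Int.descent_one_three {c m k l n : ℤ} (hc : c = 1 ∨ Prime c) (hc0 : 0 < c)
    (hc24 : c % 24 = 1) (hk : k ≠ 0) (hmk : IsCoprime m k) (h1 : m ^ 2 + c * k ^ 2 = l ^ 2)
    (h2 : m ^ 2 + 3 * (c * k ^ 2) = n ^ 2) :
    ∃ m' k' l' n', k' ≠ 0 ∧ k' ^ 2 < k ^ 2 ∧ IsCoprime m' k' ∧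
      (m' ^ 2 + c * k' ^ 2 = l' ^ 2 ∧ m' ^ 2 + 3 * (c * k' ^ 2) = n' ^ 2 ∨
        m' ^ 2 + k' ^ 2 = l' ^ 2 ∧ m' ^ 2 + 3 * k' ^ 2 = c * n' ^ 2 ∨
        c * m' ^ 2 + k' ^ 2 = l' ^ 2 ∧ c * m' ^ 2 + 3 * k' ^ 2 = n' ^ 2 ∨
        m' ^ 2 + k' ^ 2 = c * l' ^ 2 ∧ m' ^ 2 + 3 * k' ^ 2 = n' ^ 2) := by
  have h1' := congrArg (Int.cast : ℤ → ZMod 4) h1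
  have h2' := congrArg (Int.cast : ℤ → ZMod 4) h2
  push_cast at h1' h2'
  rw [zmod_four_eq_one hc24] at h1' h2'
  have hkev : Even k := by
    have : ∀ m k l n : ZMod 4, m ^ 2 + 1 * k ^ 2 = l ^ 2 → m ^ 2 + 3 * (1 * k ^ 2) = n ^ 2 →
      2 * k = 0 := by decide
    exact even_of_forall_zmod_four (this _ _ _ _ h1' h2')
  obtain ⟨f, e, hm, hk2, hl, hfe⟩ := param_sq_add_mul_sq hc hc0 h1.symm hkev hmk
  have hfe0 : f ≠ 0 ∧ e ≠ 0 := by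
    constructor <;> rintro rfl <;> apply hk <;> simpa using hk2
  obtain ⟨hf, he⟩ := hfe0
  obtain ⟨g, h, heq, hgh, hs⟩ := abs_eq_of_sq_eq_add (n := n) (t := 5) hc hc0 he rfl hfe
    (by rw [← h2, hm, hk2]; ring)
  rw [abs_of_pos (by positivity)] at hs
  have hgh0 : g ≠ 0 ∧ h ≠ 0 := by
    constructor <;> rintro rfl <;> apply he <;> simpa using heq
  obtain ⟨hg, hh⟩ := hgh0
  have hG : IsCoprime (c * g ^ 2) (h ^ 2) := hgh.of_mul_left_left.pow_right.mul_left
    hgh.of_mul_left_right.pow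
  have hgh' : IsCoprime g h := hgh.of_mul_left_right
  have pos : ∀ z : ℤ, z ≠ 0 → 1 ≤ z ^ 2 := fun z hz => by
    have : 0 < z ^ 2 := by positivity
    omega
  have hf1 := pos f hf
  have hg1 := pos g hg
  have hh1 := pos h hh
  have hc3 := zmod_three_eq_one hc24
  rw [heq] at hk2 hs
  have hkg : g ^ 2 < k ^ 2 := by
    nlinarith [mul_pos (show 0 < f ^ 2 by omega) (show 0 < h ^ 2 by omega)]
  have hkh : h ^ 2 < k ^ 2 := by
    nlinarith [mul_pos (show 0 < f ^ 2 by omega) (show 0 < g ^ 2 by omega)]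
  have hkA : ∀ A B : ℤ, B ≠ 0 → f ^ 2 = A ^ 2 * B ^ 2 → A ^ 2 < k ^ 2 := fun A B hB hfAB => by
    have hB1 := pos B hB
    nlinarith [mul_pos (show 0 < g ^ 2 by omega) (show 0 < h ^ 2 by omega), sq_nonneg A]
  rcases hs with hs | hs | hs | hs
  · obtain ⟨A, B, hA, hB, ⟨hx, hy⟩ | ⟨hx, hy⟩⟩ := sq_or_neg_sq_of_isCoprime
      (hG.of_lin_comb (-1) 1 (-2) 3 (by ring) (by ring) :
        IsCoprime (h ^ 2 - 3 * (c * g ^ 2)) (h ^ 2 - 2 * (c * g ^ 2))) hf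
      (by linear_combination hs)
    · refine ⟨A, g, B, h, hg, hkg, ?_, Or.inl ⟨by linarith, by linarith⟩⟩
      have : IsCoprime (A ^ 2) (c * g ^ 2) :=
        hG.of_lin_comb 0 1 1 3 (by ring) (by linarith)
      exact (IsCoprime.pow_iff two_pos two_pos).1 this.of_mul_right_right
    · have hx' := congrArg (Int.cast : ℤ → ZMod 3) hx
      have hy' := congrArg (Int.cast : ℤ → ZMod 3) hy
      push_cast at hx' hy'
      rw [hc3] at hx' hy'
      have : ∀ g h A B : ZMod 3, h ^ 2 - 3 * (1 * g ^ 2) = -A ^ 2 →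
          h ^ 2 - 2 * (1 * g ^ 2) = -B ^ 2 →
        g = 0 ∧ h = 0 := by decide
      obtain ⟨hg3, hh3⟩ := this _ _ _ _ hx' hy'
      exact (not_isCoprime_of_zmod_three hg3 hh3 hgh').elim
  · obtain ⟨A, B, hA, hB, ⟨hx, hy⟩ | ⟨hx, hy⟩⟩ := sq_or_neg_sq_of_isCoprime
      (hG.of_lin_comb 3 (-2) 1 (-1) (by ring) (by ring) :
        IsCoprime (c * g ^ 2 - 2 * h ^ 2) (c * g ^ 2 - 3 * h ^ 2)) hf
      (by linear_combination hs)
    · refine ⟨B, h, A, g, hh, hkh, ?_, Or.inr (Or.inl ⟨by linarith, by linarith⟩)⟩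
      have : IsCoprime (B ^ 2) (h ^ 2) :=
        hG.of_lin_comb 1 3 0 1 (by linarith) (by ring)
      exact (IsCoprime.pow_iff two_pos two_pos).1 this
    · have hx' := congrArg (Int.cast : ℤ → ZMod 3) hx
      have hy' := congrArg (Int.cast : ℤ → ZMod 3) hy
      push_cast at hx' hy'
      rw [hc3] at hx' hy'
      have : ∀ g h A B : ZMod 3, 1 * g ^ 2 - 2 * h ^ 2 = -A ^ 2 → 1 * g ^ 2 - 3 * h ^ 2 = -B ^ 2 →
        g = 0 ∧ h = 0 := by decide
      obtain ⟨hg3, hh3⟩ := this _ _ _ _ hx' hy'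
      exact (not_isCoprime_of_zmod_three hg3 hh3 hgh').elim
  · obtain ⟨B, A, hB, hA, ⟨hx, hy⟩ | ⟨hx, hy⟩⟩ := sq_or_neg_sq_of_isCoprime
      (hG.of_lin_comb 1 (-3) 1 (-2) (by ring) (by ring) :
        IsCoprime (3 * h ^ 2 - 2 * (c * g ^ 2)) (h ^ 2 - c * g ^ 2)) hf
      (by linear_combination hs)
    · refine ⟨g, A, h, B, hA, hkA A B hB ?_, ?_,
        Or.inr (Or.inr (Or.inl ⟨by linarith, by linarith⟩))⟩
      · rw [← hx, ← hy]; linear_combination hs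
      have : IsCoprime (c * g ^ 2) (A ^ 2) :=
        hG.of_lin_comb 1 0 1 1 (by ring) (by linarith)
      exact (IsCoprime.pow_iff two_pos two_pos).1 this.of_mul_left_right
    · have hx' := congrArg (Int.cast : ℤ → ZMod 3) hx
      have hy' := congrArg (Int.cast : ℤ → ZMod 3) hy
      push_cast at hx' hy'
      rw [hc3] at hx' hy'
      have : ∀ g h A B : ZMod 3, 3 * h ^ 2 - 2 * (1 * g ^ 2) = -B ^ 2 → h ^ 2 - 1 * g ^ 2 = -A ^ 2 →
        g = 0 ∧ h = 0 := by decide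
      obtain ⟨hg3, hh3⟩ := this _ _ _ _ hx' hy'
      exact (not_isCoprime_of_zmod_three hg3 hh3 hgh').elim
  · obtain ⟨B, A, hB, hA, ⟨hx, hy⟩ | ⟨hx, hy⟩⟩ := sq_or_neg_sq_of_isCoprime
      (hG.of_lin_comb 1 (-2) 1 (-3) (by ring) (by ring) :
        IsCoprime (3 * (c * g ^ 2) - 2 * h ^ 2) (c * g ^ 2 - h ^ 2)) hf
      (by linear_combination hs)
    · refine ⟨h, A, g, B, hA, hkA A B hB ?_, ?_,
        Or.inr (Or.inr (Or.inr ⟨by linarith, by linarith⟩))⟩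
      · rw [← hx, ← hy]; linear_combination hs
      have : IsCoprime (h ^ 2) (A ^ 2) :=
        hG.of_lin_comb 1 1 1 0 (by linarith) (by ring)
      exact (IsCoprime.pow_iff two_pos two_pos).1 this
    · have hx' := congrArg (Int.cast : ℤ → ZMod 3) hx
      have hy' := congrArg (Int.cast : ℤ → ZMod 3) hy
      push_cast at hx' hy'
      rw [hc3] at hx' hy'
      have : ∀ g h A B : ZMod 3, 3 * (1 * g ^ 2) - 2 * h ^ 2 = -B ^ 2 → 1 * g ^ 2 - h ^ 2 = -A ^ 2 →
        g = 0 ∧ h = 0 := by decide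
      obtain ⟨hg3, hh3⟩ := this _ _ _ _ hx' hy'
      exact (not_isCoprime_of_zmod_three hg3 hh3 hgh').elim

theorem Int.not_isCoprime_of_sq_eq {A a b x y : ℤ} (ha : a % 3 = 2) (hb : b % 3 ≠ 0)
    (h : A ^ 2 = a * x ^ 2 + 3 * (b * y ^ 2)) : ¬ IsCoprime x y := by
  intro hxy
  have h' := congrArg (Int.cast : ℤ → ZMod 3) h
  have h3 : (3 : ZMod 3) = 0 := by decide
  have ha' : (a : ZMod 3) = 2 := by
    have := (ZMod.intCast_eq_intCast_iff_dvd_sub 2 a 3).2 (by omega)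
    rw [← this]; simp
  push_cast at h'
  rw [ha', h3, zero_mul, add_zero] at h'
  have : ∀ A x : ZMod 3, A ^ 2 = 2 * x ^ 2 → A = 0 ∧ x = 0 := by decide
  obtain ⟨hA, hx⟩ := this _ _ h'
  obtain ⟨B, rfl⟩ := (ZMod.intCast_zmod_eq_zero_iff_dvd A 3).1 hA
  obtain ⟨z, rfl⟩ := (ZMod.intCast_zmod_eq_zero_iff_dvd x 3).1 hx
  push_cast at h hxy
  have hd : (3 : ℤ) ∣ b * y ^ 2 := ⟨B ^ 2 - a * z ^ 2, by linarith⟩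
  have hy : (3 : ℤ) ∣ y := by
    rcases Int.prime_three.dvd_or_dvd hd with hd | hd
    · omega
    · exact Int.prime_three.dvd_of_dvd_pow hd
  exact Int.prime_three.not_isUnit (hxy.isUnit_of_dvd' (dvd_mul_right 3 z) hy)

/-- Two-descent step for `m² + 2 c k² = □`, `m² + 3 c k² = □`. -/
theorem Int.descent_two_three {c m k l n : ℤ} (hc : c = 1 ∨ Prime c) (hc0 : 0 < c)
    (hc24 : c % 24 = 1) (hk : k ≠ 0) (hmk : IsCoprime m k)
    (h1 : m ^ 2 + 2 * (c * k ^ 2) = l ^ 2) (h2 : m ^ 2 + 3 * (c * k ^ 2) = n ^ 2) :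
    ∃ m' k' l' n', k' ≠ 0 ∧ k' ^ 2 < k ^ 2 ∧ IsCoprime m' k' ∧
      (m' ^ 2 + 2 * (c * k' ^ 2) = l' ^ 2 ∧ m' ^ 2 + 3 * (c * k' ^ 2) = n' ^ 2 ∨
        m' ^ 2 + 2 * k' ^ 2 = l' ^ 2 ∧ m' ^ 2 + 3 * k' ^ 2 = c * n' ^ 2 ∨
        c * m' ^ 2 + 2 * k' ^ 2 = l' ^ 2 ∧ c * m' ^ 2 + 3 * k' ^ 2 = n' ^ 2 ∨
        m' ^ 2 + 2 * k' ^ 2 = c * l' ^ 2 ∧ m' ^ 2 + 3 * k' ^ 2 = n' ^ 2) := by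
  have h1' := congrArg (Int.cast : ℤ → ZMod 4) h1
  have h2' := congrArg (Int.cast : ℤ → ZMod 4) h2
  push_cast at h1' h2'
  rw [zmod_four_eq_one hc24] at h1' h2'
  have hkev : Even k := by
    have : ∀ m k l n : ZMod 4, m ^ 2 + 2 * (1 * k ^ 2) = l ^ 2 → m ^ 2 + 3 * (1 * k ^ 2) = n ^ 2 →
      2 * k = 0 := by decide
    exact even_of_forall_zmod_four (this _ _ _ _ h1' h2')
  have hlk : IsCoprime l k := by
    have : IsCoprime (l ^ 2) (k ^ 2) := (hmk.pow (m := 2) (n := 2)).of_lin_comb 1 (-(2 * c)) 0 1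
      (by linarith) (by ring)
    exact (IsCoprime.pow_iff two_pos two_pos).1 this
  obtain ⟨f, e, hl, hk2, hn, hfe⟩ := param_sq_add_mul_sq (n := n) hc hc0 (by linarith) hkev hlk
  have hfe0 : f ≠ 0 ∧ e ≠ 0 := by
    constructor <;> rintro rfl <;> apply hk <;> simpa using hk2
  obtain ⟨hf, he⟩ := hfe0
  have hm : m ^ 2 = (f ^ 2 - c * e ^ 2) ^ 2 - 2 * (c * (4 * f ^ 2 * e ^ 2)) := by
    rw [← hk2, ← hl]; linarith
  obtain ⟨g, h, heq, hgh, hs⟩ := abs_eq_of_sq_eq_add (n := m) (t := -5) hc hc0 he rfl hfe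
    (by rw [hm]; ring)
  have hgh0 : g ≠ 0 ∧ h ≠ 0 := by
    constructor <;> rintro rfl <;> apply he <;> simpa using heq
  obtain ⟨hg, hh⟩ := hgh0
  have hG : IsCoprime (c * g ^ 2) (h ^ 2) := hgh.of_mul_left_left.pow_right.mul_left
    hgh.of_mul_left_right.pow
  have hgh' : IsCoprime g h := hgh.of_mul_left_right
  have pos : ∀ z : ℤ, z ≠ 0 → 1 ≤ z ^ 2 := fun z hz => by
    have : 0 < z ^ 2 := by positivity
    omega
  have hf1 := pos f hf
  have hg1 := pos g hg
  have hh1 := pos h hh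
  have hcg1 : 0 < c * g ^ 2 := by positivity
  rw [heq] at hk2 hs
  have hkg : g ^ 2 < k ^ 2 := by
    nlinarith [mul_pos (show 0 < f ^ 2 by omega) (show 0 < h ^ 2 by omega)]
  have hkh : h ^ 2 < k ^ 2 := by
    nlinarith [mul_pos (show 0 < f ^ 2 by omega) (show 0 < g ^ 2 by omega)]
  have hkB : ∀ A B : ℤ, A ≠ 0 → f ^ 2 = A ^ 2 * B ^ 2 → B ^ 2 < k ^ 2 := fun A B hA hfAB => by
    have hA1 := pos A hA
    nlinarith [mul_pos (show 0 < g ^ 2 by omega) (show 0 < h ^ 2 by omega), sq_nonneg B]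
  rcases le_total 0 (f ^ 2 + -5 * (c * (g ^ 2 * h ^ 2))) with hsign | hsign
  · rw [abs_of_nonneg hsign] at hs
    rcases hs with hs | hs | hs | hs
    · obtain ⟨A, B, hA, hB, ⟨hx, hy⟩ | ⟨hx, hy⟩⟩ := sq_or_neg_sq_of_isCoprime
        (hG.of_lin_comb 1 (-1) (-2) 3 (by ring) (by ring) :
          IsCoprime (3 * (c * g ^ 2) + h ^ 2) (2 * (c * g ^ 2) + h ^ 2)) hf
        (by linear_combination hs)
      · exact ⟨h, g, B, A, hg, hkg, hgh'.symm, Or.inl ⟨by linarith, by linarith⟩⟩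
      · nlinarith [sq_nonneg A]
    · obtain ⟨A, B, hA, hB, ⟨hx, hy⟩ | ⟨hx, hy⟩⟩ := sq_or_neg_sq_of_isCoprime
        (hG.of_lin_comb 3 (-2) (-1) 1 (by ring) (by ring) :
          IsCoprime (c * g ^ 2 + 2 * h ^ 2) (c * g ^ 2 + 3 * h ^ 2)) hf
        (by linear_combination hs)
      · exact ⟨g, h, A, B, hh, hkh, hgh', Or.inr (Or.inr (Or.inl ⟨by linarith, by linarith⟩))⟩
      · nlinarith [sq_nonneg A]
    · obtain ⟨A, B, hA, hB, ⟨hx, hy⟩ | ⟨hx, hy⟩⟩ := sq_or_neg_sq_of_isCoprime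
        (hG.of_lin_comb (-1) 3 1 (-2) (by ring) (by ring) :
          IsCoprime (2 * (c * g ^ 2) + 3 * h ^ 2) (c * g ^ 2 + h ^ 2)) hf
        (by linear_combination hs)
      · exact (not_isCoprime_of_sq_eq (A := A) (a := 2 * c) (b := 1) (x := g) (y := h) (by omega)
          (by norm_num) (by linarith) hgh').elim
      · nlinarith [sq_nonneg A]
    · obtain ⟨A, B, hA, hB, ⟨hx, hy⟩ | ⟨hx, hy⟩⟩ := sq_or_neg_sq_of_isCoprime
        (hG.of_lin_comb 1 (-2) (-1) 3 (by ring) (by ring) :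
          IsCoprime (3 * (c * g ^ 2) + 2 * h ^ 2) (c * g ^ 2 + h ^ 2)) hf
        (by linear_combination hs)
      · exact (not_isCoprime_of_sq_eq (A := A) (a := 2) (b := c) (x := h) (y := g) (by norm_num)
          (by omega) (by linarith) hgh'.symm).elim
      · nlinarith [sq_nonneg A]
  · rw [abs_of_nonpos hsign] at hs
    rcases hs with hs | hs | hs | hs
    · obtain ⟨A, B, hA, hB, ⟨hx, hy⟩ | ⟨hx, hy⟩⟩ := sq_or_neg_sq_of_isCoprime
        (hG.of_lin_comb 1 1 2 3 (by ring) (by ring) :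
          IsCoprime (3 * (c * g ^ 2) - h ^ 2) (h ^ 2 - 2 * (c * g ^ 2))) hf
        (by linear_combination -hs)
      · exact (not_isCoprime_of_sq_eq (A := A) (a := -1) (b := c) (x := h) (y := g) (by norm_num)
          (by omega) (by linarith) hgh'.symm).elim
      · nlinarith [sq_nonneg A, sq_nonneg B]
    · obtain ⟨A, B, hA, hB, ⟨hx, hy⟩ | ⟨hx, hy⟩⟩ := sq_or_neg_sq_of_isCoprime
        (hG.of_lin_comb 3 2 1 1 (by ring) (by ring) :
          IsCoprime (c * g ^ 2 - 2 * h ^ 2) (3 * h ^ 2 - c * g ^ 2)) hf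
        (by linear_combination -hs)
      · exact (not_isCoprime_of_sq_eq (A := B) (a := -c) (b := 1) (x := g) (y := h) (by omega)
          (by norm_num) (by linarith) hgh').elim
      · nlinarith [sq_nonneg A, sq_nonneg B]
    · obtain ⟨A, B, hA, hB, ⟨hx, hy⟩ | ⟨hx, hy⟩⟩ := sq_or_neg_sq_of_isCoprime
        (hG.of_lin_comb 1 3 1 2 (by ring) (by ring) :
          IsCoprime (3 * h ^ 2 - 2 * (c * g ^ 2)) (c * g ^ 2 - h ^ 2)) hf
        (by linear_combination -hs)
      · refine ⟨A, B, h, g, hB, hkB A B hA ?_, ?_, Or.inr (Or.inl ⟨by linarith, by linarith⟩)⟩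
        · rw [← hx, ← hy]; linear_combination -hs
        have : IsCoprime (A ^ 2) (B ^ 2) :=
          hG.of_lin_comb 1 3 1 2 (by linarith) (by linarith)
        exact (IsCoprime.pow_iff two_pos two_pos).1 this
      · nlinarith [sq_nonneg A, sq_nonneg B]
    · obtain ⟨A, B, hA, hB, ⟨hx, hy⟩ | ⟨hx, hy⟩⟩ := sq_or_neg_sq_of_isCoprime
        (hG.of_lin_comb 1 2 1 3 (by ring) (by ring) :
          IsCoprime (3 * (c * g ^ 2) - 2 * h ^ 2) (h ^ 2 - c * g ^ 2)) hf
        (by linear_combination -hs)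
      · refine ⟨A, B, g, h, hB, hkB A B hA ?_, ?_,
          Or.inr (Or.inr (Or.inr ⟨by linarith, by linarith⟩))⟩
        · rw [← hx, ← hy]; linear_combination -hs
        have : IsCoprime (A ^ 2) (B ^ 2) :=
          hG.of_lin_comb 1 2 1 3 (by linarith) (by linarith)
        exact (IsCoprime.pow_iff two_pos two_pos).1 this
      · nlinarith [sq_nonneg A, sq_nonneg B]

section Field

variable {K : Type*} [Field K]

theorem not_isSquare_one_add (h3 : ¬∃ w : K, w ^ 4 - 2 * w ^ 2 - 2 = 0) {r : K}
    (hr : r ^ 2 = 3) : ¬ IsSquare (1 + r) := by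
  rintro ⟨w, hw⟩
  refine h3 ⟨w, ?_⟩
  have : r = w ^ 2 - 1 := by rw [pow_two, ← hw]; ring
  subst this
  linear_combination hr

theorem not_isSquare_add (h3 : ¬∃ w : K, w ^ 4 - 2 * w ^ 2 - 2 = 0) (h20 : (2 : K) ≠ 0)
    {r s : K} (hr : r ^ 2 = 2) (hs : s ^ 2 = 3) : ¬ IsSquare (r + s) := by
  rintro ⟨w, hw⟩
  have hr0 : r ≠ 0 := by rintro rfl; apply h20; rw [← hr]; ring
  have hw0 : w ≠ 0 := by
    rintro rfl
    have : s = -r := by linear_combination hw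
    subst this
    have h1 : (1 : K) = 0 := by linear_combination hr - hs
    exact one_ne_zero h1
  refine not_isSquare_one_add h3 hs ⟨(1 + r + s) / (r * w), ?_⟩
  field_simp
  linear_combination (-r ^ 2 * (1 + s)) * hw + (r - 1 + r * s + s + s ^ 2) * hr + hs

theorem not_isSquare_add_of_sq_eq_neg_one (h3 : ¬∃ w : K, w ^ 4 - 2 * w ^ 2 - 2 = 0)
    (h20 : (2 : K) ≠ 0) (h30 : (3 : K) ≠ 0) {r s i : K} (hr : r ^ 2 = 2) (hs : s ^ 2 = 3)
    (hi : i ^ 2 = -1) : ¬ IsSquare (r + i) := by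
  rintro ⟨w, hw⟩
  have hr0 : r ≠ 0 := by rintro rfl; apply h20; rw [← hr]; ring
  have hw0 : w ≠ 0 := by
    rintro rfl
    have : i = -r := by linear_combination hw
    subst this
    apply h30
    linear_combination hi - hr
  refine not_isSquare_add h3 h20 hr hs ⟨(r + i + s) / (r * w), ?_⟩
  field_simp
  linear_combination (-r ^ 2 * (r + s)) * hw + (r ^ 2 + r * s + i * r + i * s + 1) * hr - hs - hi

/-- The quartic `x⁴ - 10 x² y² + y⁴` represents no zero at squares. -/
theorem quartic_ten_ne_zero (h3 : ¬∃ w : K, w ^ 4 - 2 * w ^ 2 - 2 = 0) (h20 : (2 : K) ≠ 0)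
    {r s x y : K} (hr : r ^ 2 = 2) (hs : s ^ 2 = 3) (hx : IsSquare x) (hy : IsSquare y)
    (hy0 : y ≠ 0) : x ^ 4 - 10 * x ^ 2 * y ^ 2 + y ^ 4 ≠ 0 := by
  intro h
  have hf : (x - (r + s) * y) * (x - (-r + -s) * y) * ((x - (r + -s) * y) * (x - (-r + s) * y))
      = 0 := by
    linear_combination h + (-2 * x ^ 2 * y ^ 2 + y ^ 4 * (r ^ 2 - 2 * s ^ 2 + 2)) * hr +
      (-2 * x ^ 2 * y ^ 2 + y ^ 4 * (s ^ 2 + 3 - 4)) * hs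
  have key : ∀ z : K, x - z * y = 0 → IsSquare z := fun z hz => by
    have : z = x / y := by rw [eq_div_iff hy0]; linear_combination -hz
    rw [this]; exact hx.div hy
  have hr' : (-r) ^ 2 = 2 := by rw [neg_sq, hr]
  have hs' : (-s) ^ 2 = 3 := by rw [neg_sq, hs]
  rcases mul_eq_zero.1 hf with hf | hf <;> rcases mul_eq_zero.1 hf with hf | hf <;>
    exact not_isSquare_add h3 h20 (by assumption) (by assumption) (key _ hf)

/-- The quartic `x⁴ - 8 x² y² + 4 y⁴` represents no zero at squares. -/
theorem quartic_eight_ne_zero (h3 : ¬∃ w : K, w ^ 4 - 2 * w ^ 2 - 2 = 0)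
    {s x y : K} (hn : IsSquare (-1 : K)) (hs : s ^ 2 = 3) (hx : IsSquare x) (hy : IsSquare y)
    (hy0 : y ≠ 0) : x ^ 4 - 8 * x ^ 2 * y ^ 2 + 4 * y ^ 4 ≠ 0 := by
  intro h
  have hf : (x - (1 + s) * y) * (x - -1 * (1 + s) * y) *
      ((x - (1 + -s) * y) * (x - -1 * (1 + -s) * y)) = 0 := by
    linear_combination h + (-2 * x ^ 2 * y ^ 2 + y ^ 4 * (s ^ 2 + 3 - 2)) * hs
  have key : ∀ z : K, x - z * y = 0 → IsSquare z := fun z hz => by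
    have : z = x / y := by rw [eq_div_iff hy0]; linear_combination -hz
    rw [this]; exact hx.div hy
  have key' : ∀ z : K, x - -1 * z * y = 0 → IsSquare z := fun z hz => by
    have := (key _ hz).mul hn
    simpa using this
  have hs' : (-s) ^ 2 = 3 := by rw [neg_sq, hs]
  rcases mul_eq_zero.1 hf with hf | hf <;> rcases mul_eq_zero.1 hf with hf | hf
  · exact not_isSquare_one_add h3 hs (key _ hf)
  · exact not_isSquare_one_add h3 hs (key' _ hf)
  · exact not_isSquare_one_add h3 hs' (key _ hf)
  · exact not_isSquare_one_add h3 hs' (key' _ hf)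

/-- The quartic `x⁴ - 2 x² y² + 9 y⁴` represents no zero at squares. -/
theorem quartic_two_ne_zero (h3 : ¬∃ w : K, w ^ 4 - 2 * w ^ 2 - 2 = 0) (h20 : (2 : K) ≠ 0)
    (h30 : (3 : K) ≠ 0) {r s i x y : K} (hr : r ^ 2 = 2) (hs : s ^ 2 = 3) (hi : i ^ 2 = -1)
    (hx : IsSquare x) (hy : IsSquare y) (hy0 : y ≠ 0) :
    x ^ 4 - 2 * x ^ 2 * y ^ 2 + 9 * y ^ 4 ≠ 0 := by
  intro h
  have hf : (x - (r + i) * y) * (x - (-r + -i) * y) * ((x - (r + -i) * y) * (x - (-r + i) * y))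
      = 0 := by
    linear_combination h + (-2 * x ^ 2 * y ^ 2 + y ^ 4 * (r ^ 2 - 2 * i ^ 2 + 2)) * hr +
      (-2 * x ^ 2 * y ^ 2 + y ^ 4 * (i ^ 2 - 1 - 4)) * hi
  have key : ∀ z : K, x - z * y = 0 → IsSquare z := fun z hz => by
    have : z = x / y := by rw [eq_div_iff hy0]; linear_combination -hz
    rw [this]; exact hx.div hy
  have hr' : (-r) ^ 2 = 2 := by rw [neg_sq, hr]
  have hi' : (-i) ^ 2 = -1 := by rw [neg_sq, hi]
  rcases mul_eq_zero.1 hf with hf | hf <;> rcases mul_eq_zero.1 hf with hf | hf <;>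
    exact not_isSquare_add_of_sq_eq_neg_one h3 h20 h30 (by assumption) hs (by assumption) (key _ hf)

end Field

section ZModp

variable {p : ℕ} [Fact p.Prime]

theorem ZMod.isSquare_natCast_of_forall_prime {n : ℕ}
    (h : ∀ q : ℕ, q.Prime → q ∣ n → IsSquare (q : ZMod p)) : IsSquare (n : ZMod p) := by
  induction n using Nat.recOnMul with
  | zero => simp
  | one => simp
  | prime q hq => exact h q hq dvd_rfl
  | mul a b ha hb =>
    push_cast
    exact (ha fun q hq hd => h q hq (hd.mul_right b)).mul
      (hb fun q hq hd => h q hq (hd.mul_left a))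

theorem ZMod.isSquare_neg_one_of_emod_eight (hp8 : p % 8 = 1) : IsSquare (-1 : ZMod p) :=
  ZMod.exists_sq_eq_neg_one_iff.2 (by omega)

theorem ZMod.isSquare_two_of_emod_eight (hp8 : p % 8 = 1) : IsSquare (2 : ZMod p) :=
  (ZMod.exists_sq_eq_two_iff (by rintro rfl; norm_num at hp8)).2 (Or.inl hp8)

theorem ZMod.isSquare_three_of_emod_twentyfour (hp24 : p % 24 = 1) : IsSquare (3 : ZMod p) := by
  have : Fact (Nat.Prime 3) := ⟨Nat.prime_three⟩
  have h := ZMod.exists_sq_eq_prime_iff_of_mod_four_eq_one (p := p) (q := 3)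
    (by omega) (by norm_num)
  have h1 : ((p : ℕ) : ZMod 3) = 1 := by
    have := (ZMod.natCast_eq_natCast_iff' p 1 3).2 (by omega)
    simpa using this
  rw [h1] at h
  exact_mod_cast h.2 IsSquare.one

theorem ZMod.exists_isSquare_sq_eq_neg_one (hp8 : p % 8 = 1) :
    ∃ i : ZMod p, i ^ 2 = -1 ∧ IsSquare i := by
  obtain ⟨i, hi⟩ := ZMod.isSquare_neg_one_of_emod_eight hp8
  have hi2 : i ^ 2 = -1 := by rw [hi, pow_two]
  refine ⟨i, hi2, ?_⟩
  have hi0 : i ≠ 0 := by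
    rintro rfl
    simp at hi
  rw [ZMod.euler_criterion p hi0]
  obtain ⟨k, hk⟩ : ∃ k, p / 2 = 2 * (2 * k) := ⟨p / 8, by omega⟩
  rw [hk, pow_mul, pow_mul, hi2]
  norm_num

/-- If `p` is a square modulo `x` up to squares prime to `x`, then `x` is a square modulo `p`. -/
theorem ZMod.isSquare_intCast_of_dvd (hp8 : p % 8 = 1) {x y g : ℤ}
    (h : x ∣ p * g ^ 2 - y ^ 2) (hxy : IsCoprime x y) : IsSquare (x : ZMod p) := by
  have hnat : IsSquare ((x.natAbs : ℕ) : ZMod p) := by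
    refine ZMod.isSquare_natCast_of_forall_prime fun q hq hqx => ?_
    have : Fact q.Prime := ⟨hq⟩
    have hqx' : (q : ℤ) ∣ x := Int.natCast_dvd.2 hqx
    by_cases hq2 : q = 2
    · subst hq2
      exact_mod_cast ZMod.isSquare_two_of_emod_eight hp8
    · refine (ZMod.exists_sq_eq_prime_iff_of_mod_four_eq_one (by omega) hq2).2 ?_
      have hy0 : (y : ZMod q) ≠ 0 := by
        intro hy
        have := hxy.isUnit_of_dvd' hqx' ((ZMod.intCast_zmod_eq_zero_iff_dvd y q).1 hy)
        exact (Nat.prime_iff_prime_int.1 hq).not_isUnit this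
      have h0 := (ZMod.intCast_zmod_eq_zero_iff_dvd _ q).2 (hqx'.trans h)
      push_cast at h0
      have hg0 : (g : ZMod q) ≠ 0 := by
        intro hg
        rw [hg] at h0
        apply hy0
        simpa using h0
      refine ⟨y / g, ?_⟩
      field_simp
      linear_combination h0
  have hx := Int.natAbs_eq x
  generalize x.natAbs = n at hnat hx
  rcases hx with rfl | rfl
  · exact_mod_cast hnat
  · simpa using (ZMod.isSquare_neg_one_of_emod_eight hp8).mul hnat

theorem ZMod.isSquare_of_quartic (hp8 : p % 8 = 1) {u v g α β : ℤ} (hco : IsCoprime u (β * v))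
    (h : p * g ^ 2 = u ^ 4 + α * u ^ 2 * v ^ 2 + β ^ 2 * v ^ 4) :
    IsSquare (u : ZMod p) ∧ IsSquare (v : ZMod p) ∧ (v : ZMod p) ≠ 0 := by
  have huv : IsCoprime u v := hco.of_mul_right_right
  refine ⟨ZMod.isSquare_intCast_of_dvd (g := g) (y := β * v * v) hp8
    ⟨u ^ 3 + α * u * v ^ 2, by linear_combination h⟩ (hco.mul_right huv),
    ZMod.isSquare_intCast_of_dvd (g := g) (y := u ^ 2) hp8
    ⟨α * u ^ 2 * v + β ^ 2 * v ^ 3, by linear_combination h⟩ huv.symm.pow_right, fun hv => ?_⟩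
  have hv' := (ZMod.intCast_zmod_eq_zero_iff_dvd v p).1 hv
  have hpp := Nat.prime_iff_prime_int.1 (Fact.out : p.Prime)
  have hu : (p : ℤ) ∣ u ^ 4 := by
    have : u ^ 4 = p * g ^ 2 - v * (α * u ^ 2 * v + β ^ 2 * v ^ 3) := by linear_combination -h
    rw [this]
    exact dvd_sub (dvd_mul_right _ _) (hv'.mul_right _)
  exact hpp.not_isUnit (huv.isUnit_of_dvd' (hpp.dvd_of_dvd_pow hu) hv')

theorem ZMod.natCast_ne_zero_of_lt {n : ℕ} (hn : n ≠ 0) (hnp : n < p) : (n : ZMod p) ≠ 0 := by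
  rw [Ne, ZMod.natCast_eq_zero_iff]
  exact fun h => absurd (Nat.le_of_dvd (Nat.pos_of_ne_zero hn) h) (by omega)

theorem ZMod.two_ne_zero_and_three_ne_zero (hp24 : p % 24 = 1) :
    (2 : ZMod p) ≠ 0 ∧ (3 : ZMod p) ≠ 0 := by
  have hp1 : p ≠ 1 := (Fact.out : p.Prime).ne_one
  exact ⟨by exact_mod_cast ZMod.natCast_ne_zero_of_lt (p := p) (n := 2) (by omega) (by omega),
    by exact_mod_cast ZMod.natCast_ne_zero_of_lt (p := p) (n := 3) (by omega) (by omega)⟩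

theorem ZMod.exists_sq_eq_two_three (hp24 : p % 24 = 1) :
    ∃ r s : ZMod p, r ^ 2 = 2 ∧ s ^ 2 = 3 := by
  obtain ⟨r, hr⟩ := ZMod.isSquare_two_of_emod_eight (p := p) (by omega)
  obtain ⟨s, hs⟩ := ZMod.isSquare_three_of_emod_twentyfour hp24
  exact ⟨r, s, by rw [hr, pow_two], by rw [hs, pow_two]⟩

/-- Multiplying by a square root of `-1` changes the sign of `v²`, and keeps squares. -/
theorem ZMod.exists_sq_eq_sign_mul_sq (hp8 : p % 8 = 1) {σ v : ℤ} (hσ : σ = 1 ∨ σ = -1)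
    (hv : IsSquare (v : ZMod p)) (hv0 : (v : ZMod p) ≠ 0) :
    ∃ z : ZMod p, z ^ 2 = σ * v ^ 2 ∧ z ^ 4 = v ^ 4 ∧ IsSquare z ∧ z ≠ 0 := by
  rcases hσ with rfl | rfl
  · exact ⟨v, by simp, rfl, hv, hv0⟩
  · obtain ⟨i, hi, hsq⟩ := ZMod.exists_isSquare_sq_eq_neg_one hp8
    refine ⟨i * v, by rw [mul_pow, hi]; simp, ?_, hsq.mul hv, mul_ne_zero ?_ hv0⟩
    · linear_combination (v ^ 4 * (i ^ 2 - 1)) * hi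
    · rintro rfl
      norm_num at hi

theorem Int.mul_sq_ne_quartic_ten (h3 : ¬∃ w : ZMod p, w ^ 4 - 2 * w ^ 2 - 2 = 0)
    (hp24 : p % 24 = 1) {σ u v g : ℤ} (hσ : σ = 1 ∨ σ = -1) (hco : IsCoprime u v) :
    (p : ℤ) * g ^ 2 ≠ u ^ 4 - 10 * σ * u ^ 2 * v ^ 2 + v ^ 4 := by
  intro h
  obtain ⟨hu, hv, hv0⟩ := ZMod.isSquare_of_quartic (p := p) (g := g) (α := -(10 * σ)) (β := 1)
    (by omega) (by simpa using hco) (by linear_combination h)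
  obtain ⟨z, hz2, hz4, hz, hz0⟩ := ZMod.exists_sq_eq_sign_mul_sq (p := p) (by omega) hσ hv hv0
  obtain ⟨r, s, hr, hs⟩ := ZMod.exists_sq_eq_two_three hp24
  refine quartic_ten_ne_zero h3 (ZMod.two_ne_zero_and_three_ne_zero hp24).1 hr hs hu hz hz0 ?_
  have h' := congrArg (Int.cast : ℤ → ZMod p) h
  push_cast at h'
  rw [ZMod.natCast_self] at h'
  rw [hz2, hz4]
  linear_combination -h'

theorem Int.mul_sq_ne_quartic_eight (h3 : ¬∃ w : ZMod p, w ^ 4 - 2 * w ^ 2 - 2 = 0)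
    (hp24 : p % 24 = 1) {σ u v g : ℤ} (hσ : σ = 1 ∨ σ = -1) (hco : IsCoprime u (2 * v)) :
    (p : ℤ) * g ^ 2 ≠ u ^ 4 - 8 * σ * u ^ 2 * v ^ 2 + 4 * v ^ 4 := by
  intro h
  obtain ⟨hu, hv, hv0⟩ := ZMod.isSquare_of_quartic (p := p) (g := g) (α := -(8 * σ)) (β := 2)
    (by omega) hco (by linear_combination h)
  obtain ⟨z, hz2, hz4, hz, hz0⟩ := ZMod.exists_sq_eq_sign_mul_sq (p := p) (by omega) hσ hv hv0
  obtain ⟨r, s, hr, hs⟩ := ZMod.exists_sq_eq_two_three hp24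
  refine quartic_eight_ne_zero h3 (ZMod.isSquare_neg_one_of_emod_eight (by omega)) hs hu hz hz0 ?_
  have h' := congrArg (Int.cast : ℤ → ZMod p) h
  push_cast at h'
  rw [ZMod.natCast_self] at h'
  rw [hz2, hz4]
  linear_combination -h'

theorem Int.mul_sq_ne_quartic_two (h3 : ¬∃ w : ZMod p, w ^ 4 - 2 * w ^ 2 - 2 = 0)
    (hp24 : p % 24 = 1) {σ u v g : ℤ} (hσ : σ = 1 ∨ σ = -1) (hco : IsCoprime u (3 * v)) :
    (p : ℤ) * g ^ 2 ≠ u ^ 4 - 2 * σ * u ^ 2 * v ^ 2 + 9 * v ^ 4 := by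
  intro h
  obtain ⟨hu, hv, hv0⟩ := ZMod.isSquare_of_quartic (p := p) (g := g) (α := -(2 * σ)) (β := 3)
    (by omega) hco (by linear_combination h)
  obtain ⟨z, hz2, hz4, hz, hz0⟩ := ZMod.exists_sq_eq_sign_mul_sq (p := p) (by omega) hσ hv hv0
  obtain ⟨r, s, hr, hs⟩ := ZMod.exists_sq_eq_two_three hp24
  obtain ⟨i, hi, -⟩ := ZMod.exists_isSquare_sq_eq_neg_one (p := p) (by omega)
  refine quartic_two_ne_zero h3 (ZMod.two_ne_zero_and_three_ne_zero hp24).1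
    (ZMod.two_ne_zero_and_three_ne_zero hp24).2 hr hs hi hu hz hz0 ?_
  have h' := congrArg (Int.cast : ℤ → ZMod p) h
  push_cast at h'
  rw [ZMod.natCast_self] at h'
  rw [hz2, hz4]
  linear_combination -h'

end ZModp

section Obstructions

variable {p : ℕ} [Fact p.Prime] {m k l n : ℤ}

theorem Int.one_three_twist_first (h3 : ¬∃ w : ZMod p, w ^ 4 - 2 * w ^ 2 - 2 = 0)
    (hp24 : p % 24 = 1) (hmk : IsCoprime m k) (h1 : p * m ^ 2 + k ^ 2 = l ^ 2)
    (h2 : p * m ^ 2 + 3 * k ^ 2 = n ^ 2) : False := by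
  have h1' := congrArg (Int.cast : ℤ → ZMod 4) h1
  have h2' := congrArg (Int.cast : ℤ → ZMod 4) h2
  have hp4 : (p : ZMod 4) = 1 := by
    exact_mod_cast zmod_four_eq_one (c := p) (by omega)
  push_cast at h1' h2'
  rw [hp4] at h1' h2'
  have hkev : Even k := by
    have : ∀ m k l n : ZMod 4, 1 * m ^ 2 + k ^ 2 = l ^ 2 →
        1 * m ^ 2 + 3 * k ^ 2 = n ^ 2 → 2 * k = 0 := by decide
    exact even_of_forall_zmod_four (this _ _ _ _ h1' h2')
  have hlk : IsCoprime l k := by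
    have hpp := Nat.prime_iff_prime_int.1 (Fact.out : p.Prime)
    refine isCoprime_of_prime_dvd ?_ fun r hr hrl hrk => ?_
    · rintro ⟨rfl, rfl⟩
      have hm : m = 0 := by simpa [(Fact.out : p.Prime).ne_zero] using h1
      subst hm
      exact absurd (isCoprime_zero_right.1 hmk) (by simp)
    · have hd : r * r ∣ p * m ^ 2 := by
        have : (p : ℤ) * m ^ 2 = l * l - k * (1 * k) := by linear_combination h1
        rw [this]
        exact dvd_sub (mul_dvd_mul hrl hrl) (mul_dvd_mul hrk (hrk.mul_left _))
      have hrm : IsCoprime r m := (hmk.of_isCoprime_of_dvd_right hrk).symm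
      have := (hrm.mul_left hrm).pow_right (n := 2) |>.dvd_of_dvd_mul_right hd
      exact hr.not_isUnit (hpp.irreducible.squarefree r this)
  obtain ⟨u, v, hb, hk2, -, huv⟩ := param_sq_add_mul_sq (q := 2) (n := n)
    (Or.inr Int.prime_two) (by norm_num)
    (by linear_combination h1 - h2) hkev hlk
  exact mul_sq_ne_quartic_eight (g := m) (σ := 1) h3 hp24 (by norm_num) (huv)
    (by linear_combination h1 + hb - 1 * hk2)

theorem Int.one_three_twist_second (h3 : ¬∃ w : ZMod p, w ^ 4 - 2 * w ^ 2 - 2 = 0)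
    (hp24 : p % 24 = 1) (hmk : IsCoprime m k) (h1 : m ^ 2 + k ^ 2 = p * l ^ 2)
    (h2 : m ^ 2 + 3 * k ^ 2 = n ^ 2) : False := by
  have h1' := congrArg (Int.cast : ℤ → ZMod 4) h1
  have h2' := congrArg (Int.cast : ℤ → ZMod 4) h2
  have hp4 : (p : ZMod 4) = 1 := by
    exact_mod_cast zmod_four_eq_one (c := p) (by omega)
  push_cast at h1' h2'
  rw [hp4] at h1'
  have hkev : Even k := by
    have : ∀ m k l n : ZMod 4, m ^ 2 + k ^ 2 = 1 * l ^ 2 →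
        m ^ 2 + 3 * k ^ 2 = n ^ 2 → 2 * k = 0 := by decide
    exact even_of_forall_zmod_four (this _ _ _ _ h1' h2')
  obtain ⟨u, v, hb, hk2, -, huv⟩ := param_sq_add_mul_sq (q := 3) (n := n)
    (Or.inr Int.prime_three) (by norm_num)
    (by linear_combination -h2) hkev hmk
  exact mul_sq_ne_quartic_two (g := l) (σ := 1) h3 hp24 (by norm_num) (huv)
    (by linear_combination -h1 + hb + 1 * hk2)

theorem Int.one_three_twist_third (h3 : ¬∃ w : ZMod p, w ^ 4 - 2 * w ^ 2 - 2 = 0)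
    (hp24 : p % 24 = 1) (hmk : IsCoprime m k) (h1 : m ^ 2 + k ^ 2 = l ^ 2)
    (h2 : m ^ 2 + 3 * k ^ 2 = p * n ^ 2) : False := by
  have h1' := congrArg (Int.cast : ℤ → ZMod 4) h1
  have h2' := congrArg (Int.cast : ℤ → ZMod 4) h2
  have hp4 : (p : ZMod 4) = 1 := by
    exact_mod_cast zmod_four_eq_one (c := p) (by omega)
  push_cast at h1' h2'
  rw [hp4] at h2'
  have hkev : Even k := by
    have : ∀ m k l n : ZMod 4, m ^ 2 + k ^ 2 = l ^ 2 →
        m ^ 2 + 3 * k ^ 2 = 1 * n ^ 2 → 2 * k = 0 := by decide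
    exact even_of_forall_zmod_four (this _ _ _ _ h1' h2')
  obtain ⟨u, v, hb, hk2, -, huv⟩ := param_sq_add_mul_sq (q := 1) (n := l) (Or.inl rfl) (by norm_num)
    (by linear_combination -h1) hkev hmk
  exact mul_sq_ne_quartic_ten (g := n) (σ := -1) h3 hp24 (by norm_num) (by simpa using huv)
    (by linear_combination -h2 + hb + 3 * hk2)

theorem Int.two_three_twist_first (h3 : ¬∃ w : ZMod p, w ^ 4 - 2 * w ^ 2 - 2 = 0)
    (hp24 : p % 24 = 1) (hmk : IsCoprime m k) (h1 : p * m ^ 2 + 2 * k ^ 2 = l ^ 2)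
    (h2 : p * m ^ 2 + 3 * k ^ 2 = n ^ 2) : False := by
  have h1' := congrArg (Int.cast : ℤ → ZMod 4) h1
  have h2' := congrArg (Int.cast : ℤ → ZMod 4) h2
  have hp4 : (p : ZMod 4) = 1 := by
    exact_mod_cast zmod_four_eq_one (c := p) (by omega)
  push_cast at h1' h2'
  rw [hp4] at h1' h2'
  have hkev : Even k := by
    have : ∀ m k l n : ZMod 4, 1 * m ^ 2 + 2 * k ^ 2 = l ^ 2 →
        1 * m ^ 2 + 3 * k ^ 2 = n ^ 2 → 2 * k = 0 := by decide
    exact even_of_forall_zmod_four (this _ _ _ _ h1' h2')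
  have hlk : IsCoprime l k := by
    have hpp := Nat.prime_iff_prime_int.1 (Fact.out : p.Prime)
    refine isCoprime_of_prime_dvd ?_ fun r hr hrl hrk => ?_
    · rintro ⟨rfl, rfl⟩
      have hm : m = 0 := by simpa [(Fact.out : p.Prime).ne_zero] using h1
      subst hm
      exact absurd (isCoprime_zero_right.1 hmk) (by simp)
    · have hd : r * r ∣ p * m ^ 2 := by
        have : (p : ℤ) * m ^ 2 = l * l - k * (2 * k) := by linear_combination h1
        rw [this]
        exact dvd_sub (mul_dvd_mul hrl hrl) (mul_dvd_mul hrk (hrk.mul_left _))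
      have hrm : IsCoprime r m := (hmk.of_isCoprime_of_dvd_right hrk).symm
      have := (hrm.mul_left hrm).pow_right (n := 2) |>.dvd_of_dvd_mul_right hd
      exact hr.not_isUnit (hpp.irreducible.squarefree r this)
  obtain ⟨u, v, hb, hk2, -, huv⟩ := param_sq_add_mul_sq (q := 1) (n := n) (Or.inl rfl) (by norm_num)
    (by linear_combination h1 - h2) hkev hlk
  exact mul_sq_ne_quartic_ten (g := m) (σ := 1) h3 hp24 (by norm_num) (by simpa using huv)
    (by linear_combination h1 + hb - 2 * hk2)

theorem Int.two_three_twist_second (h3 : ¬∃ w : ZMod p, w ^ 4 - 2 * w ^ 2 - 2 = 0)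
    (hp24 : p % 24 = 1) (hmk : IsCoprime m k) (h1 : m ^ 2 + 2 * k ^ 2 = p * l ^ 2)
    (h2 : m ^ 2 + 3 * k ^ 2 = n ^ 2) : False := by
  have h1' := congrArg (Int.cast : ℤ → ZMod 4) h1
  have h2' := congrArg (Int.cast : ℤ → ZMod 4) h2
  have hp4 : (p : ZMod 4) = 1 := by
    exact_mod_cast zmod_four_eq_one (c := p) (by omega)
  push_cast at h1' h2'
  rw [hp4] at h1'
  have hkev : Even k := by
    have : ∀ m k l n : ZMod 4, m ^ 2 + 2 * k ^ 2 = 1 * l ^ 2 →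
        m ^ 2 + 3 * k ^ 2 = n ^ 2 → 2 * k = 0 := by decide
    exact even_of_forall_zmod_four (this _ _ _ _ h1' h2')
  obtain ⟨u, v, hb, hk2, -, huv⟩ := param_sq_add_mul_sq (q := 3) (n := n)
    (Or.inr Int.prime_three) (by norm_num)
    (by linear_combination -h2) hkev hmk
  exact mul_sq_ne_quartic_two (g := l) (σ := -1) h3 hp24 (by norm_num) (huv)
    (by linear_combination -h1 + hb + 2 * hk2)

theorem Int.two_three_twist_third (h3 : ¬∃ w : ZMod p, w ^ 4 - 2 * w ^ 2 - 2 = 0)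
    (hp24 : p % 24 = 1) (hmk : IsCoprime m k) (h1 : m ^ 2 + 2 * k ^ 2 = l ^ 2)
    (h2 : m ^ 2 + 3 * k ^ 2 = p * n ^ 2) : False := by
  have h1' := congrArg (Int.cast : ℤ → ZMod 4) h1
  have h2' := congrArg (Int.cast : ℤ → ZMod 4) h2
  have hp4 : (p : ZMod 4) = 1 := by
    exact_mod_cast zmod_four_eq_one (c := p) (by omega)
  push_cast at h1' h2'
  rw [hp4] at h2'
  have hkev : Even k := by
    have : ∀ m k l n : ZMod 4, m ^ 2 + 2 * k ^ 2 = l ^ 2 →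
        m ^ 2 + 3 * k ^ 2 = 1 * n ^ 2 → 2 * k = 0 := by decide
    exact even_of_forall_zmod_four (this _ _ _ _ h1' h2')
  obtain ⟨u, v, hb, hk2, -, huv⟩ := param_sq_add_mul_sq (q := 2) (n := l)
    (Or.inr Int.prime_two) (by norm_num)
    (by linear_combination -h1) hkev hmk
  exact mul_sq_ne_quartic_eight (g := n) (σ := -1) h3 hp24 (by norm_num) (huv)
    (by linear_combination -h2 + hb + 3 * hk2)

theorem Int.one_three_untwisted (hk : k ≠ 0) (hmk : IsCoprime m k)
    (h1 : m ^ 2 + k ^ 2 = l ^ 2) (h2 : m ^ 2 + 3 * k ^ 2 = n ^ 2) : False := by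
  induction hN : k.natAbs using Nat.strong_induction_on generalizing m k l n with
  | _ N ih =>
    obtain ⟨m', k', l', n', hk', hlt, hc, h⟩ := descent_one_three (c := 1) (Or.inl rfl) one_pos
      (by norm_num) hk hmk (by simpa using h1) (by simpa using h2)
    simp only [one_mul, or_self] at h
    exact ih _ (hN ▸ Int.natAbs_lt_iff_sq_lt.2 hlt) hk' hc h.1 h.2 rfl

theorem Int.one_three_twist_fourth (h3 : ¬∃ w : ZMod p, w ^ 4 - 2 * w ^ 2 - 2 = 0)
    (hp24 : p % 24 = 1) (hk : k ≠ 0) (hmk : IsCoprime m k)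
    (h1 : m ^ 2 + p * k ^ 2 = l ^ 2) (h2 : m ^ 2 + 3 * (p * k ^ 2) = n ^ 2) : False := by
  have hpp := (Fact.out : p.Prime)
  induction hN : k.natAbs using Nat.strong_induction_on generalizing m k l n with
  | _ N ih =>
    obtain ⟨m', k', l', n', hk', hlt, hc, h⟩ := descent_one_three (c := p)
      (Or.inr (Nat.prime_iff_prime_int.1 hpp)) (by exact_mod_cast hpp.pos) (by omega) hk hmk h1 h2
    rcases h with h | h | h | h
    · exact ih _ (hN ▸ Int.natAbs_lt_iff_sq_lt.2 hlt) hk' hc h.1 h.2 rfl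
    · exact one_three_twist_third h3 hp24 hc h.1 h.2
    · exact one_three_twist_first h3 hp24 hc h.1 h.2
    · exact one_three_twist_second h3 hp24 hc h.1 h.2

theorem Int.two_three_untwisted (hk : k ≠ 0) (hmk : IsCoprime m k)
    (h1 : m ^ 2 + 2 * k ^ 2 = l ^ 2) (h2 : m ^ 2 + 3 * k ^ 2 = n ^ 2) : False := by
  induction hN : k.natAbs using Nat.strong_induction_on generalizing m k l n with
  | _ N ih =>
    obtain ⟨m', k', l', n', hk', hlt, hc, h⟩ := descent_two_three (c := 1) (Or.inl rfl) one_pos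
      (by norm_num) hk hmk (by simpa using h1) (by simpa using h2)
    simp only [one_mul, or_self] at h
    exact ih _ (hN ▸ Int.natAbs_lt_iff_sq_lt.2 hlt) hk' hc h.1 h.2 rfl

theorem Int.two_three_twist_fourth (h3 : ¬∃ w : ZMod p, w ^ 4 - 2 * w ^ 2 - 2 = 0)
    (hp24 : p % 24 = 1) (hk : k ≠ 0) (hmk : IsCoprime m k)
    (h1 : m ^ 2 + 2 * (p * k ^ 2) = l ^ 2) (h2 : m ^ 2 + 3 * (p * k ^ 2) = n ^ 2) : False := by
  have hpp := (Fact.out : p.Prime)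
  induction hN : k.natAbs using Nat.strong_induction_on generalizing m k l n with
  | _ N ih =>
    obtain ⟨m', k', l', n', hk', hlt, hc, h⟩ := descent_two_three (c := p)
      (Or.inr (Nat.prime_iff_prime_int.1 hpp)) (by exact_mod_cast hpp.pos) (by omega) hk hmk h1 h2
    rcases h with h | h | h | h
    · exact ih _ (hN ▸ Int.natAbs_lt_iff_sq_lt.2 hlt) hk' hc h.1 h.2 rfl
    · exact two_three_twist_third h3 hp24 hc h.1 h.2
    · exact two_three_twist_first h3 hp24 hc h.1 h.2
    · exact two_three_twist_second h3 hp24 hc h.1 h.2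

/-- All four integers are squares, except that one of them may be `p` times a square. -/
def SquaresUpToTwist (p : ℕ) (a b c d : ℤ) : Prop :=
  (∃ x y z t, a = x ^ 2 ∧ b = y ^ 2 ∧ c = z ^ 2 ∧ d = t ^ 2) ∨
    (∃ x y z t, a = p * x ^ 2 ∧ b = y ^ 2 ∧ c = z ^ 2 ∧ d = t ^ 2) ∨
    (∃ x y z t, a = x ^ 2 ∧ b = p * y ^ 2 ∧ c = z ^ 2 ∧ d = t ^ 2) ∨
    (∃ x y z t, a = x ^ 2 ∧ b = y ^ 2 ∧ c = p * z ^ 2 ∧ d = t ^ 2) ∨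
    ∃ x y z t, a = x ^ 2 ∧ b = y ^ 2 ∧ c = z ^ 2 ∧ d = p * t ^ 2

theorem SquaresUpToTwist.false_of_one_three (h3 : ¬∃ w : ZMod p, w ^ 4 - 2 * w ^ 2 - 2 = 0)
    (hp24 : p % 24 = 1) (h : SquaresUpToTwist p m k l n) (hk : k ≠ 0) (hmk : IsCoprime m k)
    (hl : l = m + k) (hn : n = m + 3 * k) : False := by
  rcases h with ⟨x, y, z, t, rfl, rfl, rfl, rfl⟩ | ⟨x, y, z, t, rfl, rfl, rfl, rfl⟩ |
    ⟨x, y, z, t, rfl, rfl, rfl, rfl⟩ | ⟨x, y, z, t, rfl, rfl, rfl, rfl⟩ |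
    ⟨x, y, z, t, rfl, rfl, rfl, rfl⟩
  · exact Int.one_three_untwisted (by rintro rfl; simp at hk)
      ((IsCoprime.pow_iff two_pos two_pos).1 hmk) hl.symm hn.symm
  · exact Int.one_three_twist_first h3 hp24
      ((IsCoprime.pow_iff two_pos two_pos).1 hmk.of_mul_left_right) hl.symm hn.symm
  · exact Int.one_three_twist_fourth h3 hp24 (by rintro rfl; simp at hk)
      ((IsCoprime.pow_iff two_pos two_pos).1 hmk.of_mul_right_right) hl.symm hn.symm
  · exact Int.one_three_twist_second h3 hp24
      ((IsCoprime.pow_iff two_pos two_pos).1 hmk) hl.symm hn.symm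
  · exact Int.one_three_twist_third h3 hp24
      ((IsCoprime.pow_iff two_pos two_pos).1 hmk) hl.symm hn.symm

theorem SquaresUpToTwist.false_of_two_three (h3 : ¬∃ w : ZMod p, w ^ 4 - 2 * w ^ 2 - 2 = 0)
    (hp24 : p % 24 = 1) (h : SquaresUpToTwist p m k l n) (hk : k ≠ 0) (hmk : IsCoprime m k)
    (hl : l = m + 2 * k) (hn : n = m + 3 * k) : False := by
  rcases h with ⟨x, y, z, t, rfl, rfl, rfl, rfl⟩ | ⟨x, y, z, t, rfl, rfl, rfl, rfl⟩ |
    ⟨x, y, z, t, rfl, rfl, rfl, rfl⟩ | ⟨x, y, z, t, rfl, rfl, rfl, rfl⟩ |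
    ⟨x, y, z, t, rfl, rfl, rfl, rfl⟩
  · exact Int.two_three_untwisted (by rintro rfl; simp at hk)
      ((IsCoprime.pow_iff two_pos two_pos).1 hmk) hl.symm hn.symm
  · exact Int.two_three_twist_first h3 hp24
      ((IsCoprime.pow_iff two_pos two_pos).1 hmk.of_mul_left_right) hl.symm hn.symm
  · exact Int.two_three_twist_fourth h3 hp24 (by rintro rfl; simp at hk)
      ((IsCoprime.pow_iff two_pos two_pos).1 hmk.of_mul_right_right) hl.symm hn.symm
  · exact Int.two_three_twist_second h3 hp24
      ((IsCoprime.pow_iff two_pos two_pos).1 hmk) hl.symm hn.symm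
  · exact Int.two_three_twist_third h3 hp24
      ((IsCoprime.pow_iff two_pos two_pos).1 hmk) hl.symm hn.symm

end Obstructions

theorem Int.isCoprime_two_of_not_even {m : ℤ} (hm : ¬ Even m) : IsCoprime m 2 := by
  obtain ⟨k, rfl⟩ := Int.not_even_iff_odd.1 hm
  exact ⟨1, -k, by ring⟩

theorem Int.exists_pow_four_of_sq_mul_sq {M N r : ℤ} (hM : M ≠ 0) (hN : N ≠ 0)
    (h : IsCoprime M N) (e : M ^ 2 * N ^ 2 = r ^ 4) :
    ∃ x y, r ^ 2 = x ^ 2 * y ^ 2 ∧ IsCoprime x y ∧ M ^ 2 = x ^ 4 ∧ N ^ 2 = y ^ 4 := by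
  have hM2 : 0 < M ^ 2 := by positivity
  have hN2 : 0 < N ^ 2 := by positivity
  obtain ⟨g, k, h1, h2, ⟨h3, h4⟩ | ⟨h3, h4⟩⟩ := factor_sq_mul_pow_four (c := 1) (e := r)
    (Or.inl rfl) one_pos hM2 hN2 h.pow (by rw [e]; ring)
  · exact ⟨g, k, h1, by simpa using h2, by linarith, h4⟩
  · exact ⟨k, g, by rw [h1]; ring, by simpa using h2.symm, h3, by linarith⟩

theorem Int.pow_four_ne_sq_add_four_mul_pow_four {s r q : ℤ} (hr : r ≠ 0)
    (hq : IsCoprime q (2 * r)) :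
    s ^ 4 ≠ q ^ 2 + 4 * r ^ 4 := by
  intro h
  have hq' : IsCoprime q (2 * r ^ 2) :=
    hq.of_mul_right_left.mul_right hq.of_mul_right_right.pow_right
  obtain ⟨M, N, -, hk, hs, hMN⟩ := param_sq_add_mul_sq (q := 1) (n := s ^ 2) (Or.inl rfl) one_pos
    (by linear_combination h) (even_two_mul (r ^ 2)) hq'
  have h0 : M ≠ 0 ∧ N ≠ 0 := by
    constructor <;> rintro rfl <;> apply hr <;> simpa using hk
  rw [one_mul] at hMN
  obtain ⟨x, y, hxy, -, hx, hy⟩ := exists_pow_four_of_sq_mul_sq (r := r) h0.1 h0.2 hMN (by linarith)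
  have hxy0 : x ≠ 0 ∧ y ≠ 0 := by
    constructor <;> rintro rfl <;> apply hr <;> simpa using hxy
  have : s ^ 2 = M ^ 2 + 1 * N ^ 2 :=
    (pow_left_inj₀ (by positivity) (by positivity) two_ne_zero).1 hs
  exact not_fermat_42 hxy0.1 hxy0.2 (c := s) (by linarith)

theorem Int.pow_four_sub_pow_four_ne_sq {s r q : ℤ} (hr : r ≠ 0) (hr2 : Even r)
    (hq : IsCoprime s r) : s ^ 4 ≠ q ^ 2 + r ^ 4 := by
  induction hN : r.natAbs using Nat.strong_induction_on generalizing s r q with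
  | _ n ih =>
  intro h
  have hqr : IsCoprime q r := by
    have : IsCoprime (q ^ 2) (r ^ 4) := (hq.pow (m := 4) (n := 4)).of_lin_comb 1 1 0 1
      (by linarith) (by ring)
    exact (IsCoprime.pow_iff two_pos four_pos).1 this
  obtain ⟨M, N, -, hk, hs, hMN⟩ := param_sq_add_mul_sq (q := 1) (n := s ^ 2) (Or.inl rfl) one_pos
    (by linear_combination h) (hr2.pow_of_ne_zero two_ne_zero) (hqr.pow_right (n := 2))
  have hs2 : s ^ 2 = M ^ 2 + N ^ 2 := by
    have := (pow_left_inj₀ (by positivity) (by positivity) two_ne_zero).1 hs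
    linarith
  rw [one_mul] at hMN
  have hsodd : ¬ Even s := fun hs => by
    have := hq.isUnit_of_dvd' (even_iff_two_dvd.1 hs) (even_iff_two_dvd.1 hr2)
    exact Int.prime_two.not_isUnit this
  obtain ⟨r', rfl⟩ := hr2
  have hkey : ∀ M N : ℤ, s ^ 2 = M ^ 2 + N ^ 2 → Even N → IsCoprime M N →
      ((r' + r') ^ 2) ^ 2 = 4 * M ^ 2 * N ^ 2 → False := by
    clear hs2 hMN hs hk M N
    intro M N hs hN2 hMN hk
    obtain ⟨N, rfl⟩ := hN2
    have h0 : M ≠ 0 ∧ N ≠ 0 := by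
      constructor <;> rintro rfl <;> apply hr <;> simpa using hk
    have hr0 : r' ≠ 0 := by rintro rfl; simp at hr
    have hMN' : IsCoprime M N := by
      rw [← two_mul] at hMN
      exact hMN.of_mul_right_right
    obtain ⟨x, y, hxy, hcxy, hx, hy⟩ := exists_pow_four_of_sq_mul_sq (r := r') h0.1 h0.2 hMN'
      (by linarith)
    have hxy0 : x ≠ 0 ∧ y ≠ 0 := by
      constructor <;> rintro rfl <;> apply hr0 <;> simpa using hxy
    have hxodd : ¬ Even x := fun he => by
      apply hsodd
      have : Even (s ^ 2) := by
        have : s ^ 2 = x ^ 4 + 2 * (2 * y ^ 4) := by rw [hs, hx, ← hy]; ring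
        rw [this]
        exact (he.pow_of_ne_zero four_ne_zero).add (even_two_mul _)
      exact (Int.even_pow.1 this).1
    have hx2 : IsCoprime (x ^ 2) (2 * y ^ 2) := by
      refine (IsCoprime.mul_right ?_ hcxy.pow_right).pow_left
      exact isCoprime_two_of_not_even hxodd
    obtain ⟨P, Q, hb, hk2, -, hPQ⟩ := param_sq_add_mul_sq (q := 1) (n := s) (Or.inl rfl) one_pos
      (by rw [hs, hx]; linear_combination 4 * hy) (even_two_mul (y ^ 2)) hx2
    rw [one_mul] at hPQ
    have hPQ0 : P ≠ 0 ∧ Q ≠ 0 := by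
      constructor <;> rintro rfl <;> apply hxy0.2 <;> simpa using hk2
    obtain ⟨X, Y, hXY, hcXY, hX, hY⟩ := exists_pow_four_of_sq_mul_sq (r := y) hPQ0.1 hPQ0.2 hPQ
      (by linarith)
    have hXY0 : X ≠ 0 ∧ Y ≠ 0 := by
      constructor <;> rintro rfl <;> apply hxy0.2 <;> simpa using hXY
    have hfin : ∀ X Y : ℤ, Y ≠ 0 → X ≠ 0 → IsCoprime X Y → y ^ 2 = X ^ 2 * Y ^ 2 →
        X ^ 4 = x ^ 2 + Y ^ 4 → False := by
      intro X Y hY hX hc hyy he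
      refine ih Y.natAbs ?_ hY ?_ hc rfl he
      · rw [← hN, Int.natAbs_lt_iff_sq_lt]
        have hX' : 0 < X ^ 2 := by positivity
        have hY' : 0 < Y ^ 2 := by positivity
        have hx' : 0 < x ^ 2 := by have := hxy0.1; positivity
        have : (r' + r') ^ 2 = 4 * (x ^ 2 * (X ^ 2 * Y ^ 2)) := by rw [← hyy, ← hxy]; ring
        rw [this]
        nlinarith [mul_pos hx' hX']
      · have he' := congrArg (Int.cast : ℤ → ZMod 4) he
        push_cast at he'
        have h1 : ∀ X Y x : ZMod 4, X ^ 4 = x ^ 2 + Y ^ 4 → 2 * Y = 0 ∨ 2 * x = 0 := by decide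
        rcases h1 _ _ _ he' with h1 | h1
        · exact even_of_forall_zmod_four h1
        · exact (hxodd (even_of_forall_zmod_four h1)).elim
    have hxx : (x ^ 2 - (X ^ 4 - Y ^ 4)) * (x ^ 2 - (Y ^ 4 - X ^ 4)) = 0 := by
      rw [← hX, ← hY]; linear_combination hb
    rcases mul_eq_zero.1 hxx with hxx | hxx
    · exact hfin X Y hXY0.2 hXY0.1 hcXY hXY (by linarith)
    · exact hfin Y X hXY0.1 hXY0.2 hcXY.symm (by rw [hXY]; ring) (by linarith)
  have hev : Even (M ^ 2 * N ^ 2) := by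
    have : M ^ 2 * N ^ 2 = 2 * (2 * r' ^ 4) := by linarith
    rw [this]; exact even_two_mul _
  rcases Int.even_mul.1 hev with he | he
  · exact hkey N M (by linarith) (Int.even_pow.1 he).1 hMN.symm (by linarith)
  · exact hkey M N hs2 (Int.even_pow.1 he).1 hMN hk

theorem Int.isCoprime_of_four_combination {m a b x y : ℤ} (hm : ¬ Even m) (h : IsCoprime a b)
    (hxy : m ^ 2 = x * y) (α β γ δ : ℤ) (ha : 4 * a = α * x + β * y)
    (hb : 4 * b = γ * x + δ * y) : IsCoprime x y := by
  refine isCoprime_of_prime_dvd ?_ fun r hr hx hy => ?_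
  · rintro ⟨rfl, rfl⟩
    apply hm
    have : m = 0 := by simpa using hxy
    rw [this]; exact Even.zero
  · have h4 : IsCoprime r (4 : ℤ) := by
      have h2 := isCoprime_two_of_not_even hm
      have hrm : r ∣ m := hr.dvd_of_dvd_pow (hxy ▸ hx.mul_right y)
      have := h2.of_isCoprime_of_dvd_left hrm
      simpa using (this.mul_right this)
    have hra : r ∣ 4 * a := ha ▸ dvd_add (hx.mul_left _) (hy.mul_left _)
    have hrb : r ∣ 4 * b := hb ▸ dvd_add (hx.mul_left _) (hy.mul_left _)
    exact hr.not_isUnit (h.isUnit_of_dvd' (h4.dvd_of_dvd_mul_left hra) (h4.dvd_of_dvd_mul_left hrb))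

theorem Int.one_four_descent {α b c d : ℤ} (hα : α ≠ 0) (hc : IsCoprime α b)
    (h1 : b ^ 2 - α ^ 2 = d ^ 2) (h2 : b ^ 2 - 4 * α ^ 2 = c ^ 2) : False := by
  induction hN : α.natAbs using Nat.strong_induction_on generalizing α b c d with
  | _ n ih =>
  have hpar : Even α ∧ ¬ Even b := by
    rcases Int.even_or_odd α with ha | ha <;> rcases Int.even_or_odd b with hb | hb
    · have := hc.isUnit_of_dvd' (even_iff_two_dvd.1 ha) (even_iff_two_dvd.1 hb)
      exact (Int.prime_two.not_isUnit this).elim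
    · exact ⟨ha, Int.not_even_iff_odd.2 hb⟩
    · exfalso
      obtain ⟨i, rfl⟩ := ha
      obtain ⟨j, rfl⟩ := hb
      have h1' := congrArg (Int.cast : ℤ → ZMod 4) h1
      push_cast at h1'
      have : ∀ i j d : ZMod 4, (j + j) ^ 2 - (2 * i + 1) ^ 2 ≠ d ^ 2 := by decide
      exact this _ _ _ h1'
    · exfalso
      obtain ⟨i, rfl⟩ := ha
      obtain ⟨j, rfl⟩ := hb
      have h2' := congrArg (Int.cast : ℤ → ZMod 8) h2
      push_cast at h2'
      have : ∀ i j d : ZMod 8, (2 * j + 1) ^ 2 - 4 * (2 * i + 1) ^ 2 ≠ d ^ 2 := by decide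
      exact this _ _ _ h2'
  obtain ⟨hαe, hbo⟩ := hpar
  have hcα : IsCoprime c (2 * α) := by
    have : IsCoprime (c ^ 2) ((2 * α) ^ 2) := by
      have h0 : IsCoprime b (2 * α) := (isCoprime_two_of_not_even hbo).mul_right hc.symm
      exact (h0.pow (m := 2) (n := 2)).of_lin_comb 1 1 0 1 (by linarith) (by ring)
    exact (IsCoprime.pow_iff two_pos two_pos).1 this
  obtain ⟨m, n', -, hk, hb, hmn⟩ := param_sq_add_mul_sq (q := 1) (n := b) (Or.inl rfl) one_pos
    (by linear_combination h2) (even_two_mul α) hcα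
  rw [one_mul] at hmn hb
  have key : ∀ m n' : ℤ, Even n' → IsCoprime m n' → (2 * α) ^ 2 = 4 * m ^ 2 * n' ^ 2 →
      b ^ 2 = (m ^ 2 + n' ^ 2) ^ 2 → False := by
    clear hmn hb hk m n'
    intro m n' hn hmn hk hb
    have hmo : ¬ Even m := fun he => by
      have := hmn.isUnit_of_dvd' (even_iff_two_dvd.1 he) (even_iff_two_dvd.1 hn)
      exact Int.prime_two.not_isUnit this
    obtain ⟨ν, rfl⟩ := hn
    have hν0 : ν ≠ 0 := by rintro rfl; apply hα; simpa using hk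
    have hm0 : m ≠ 0 := by rintro rfl; apply hα; simpa using hk
    have hmν : IsCoprime m ν := by
      rw [← two_mul] at hmn
      exact hmn.of_mul_right_right
    have hα2 : α ^ 2 = 4 * (m ^ 2 * ν ^ 2) := by linarith
    have hd : |d| ^ 2 = (m ^ 2 + 2 * ν ^ 2) ^ 2 + 12 * ν ^ 4 := by
      rw [sq_abs, ← h1, hb]; linear_combination -hα2
    have hlt : ∀ g h : ℤ, g ≠ 0 → h ≠ 0 → ν ^ 2 = g ^ 2 * h ^ 2 → h.natAbs < n := by
      intro g h hg hh e
      rw [← hN, Int.natAbs_lt_iff_sq_lt, hα2, e]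
      have hg' : 1 ≤ g ^ 2 := by have : 0 < g ^ 2 := by positivity
                                 omega
      have hh' : 0 < h ^ 2 := by positivity
      have hm' : 1 ≤ m ^ 2 := by have : 0 < m ^ 2 := by positivity
                                 omega
      have : 1 ≤ m ^ 2 * g ^ 2 := by nlinarith
      nlinarith
    obtain ⟨X, hX⟩ : ∃ X, |d| = m ^ 2 + 2 * ν ^ 2 + 2 * X := by
      have hev : Even (|d| - (m ^ 2 + 2 * ν ^ 2)) := by
        have : Even (|d| ^ 2 - (m ^ 2 + 2 * ν ^ 2) ^ 2) :=
          ⟨6 * ν ^ 4, by rw [hd]; ring⟩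
        rw [Int.even_sub, Int.even_pow' two_ne_zero, Int.even_pow' two_ne_zero] at this
        exact Int.even_sub.2 this
      obtain ⟨X, hX⟩ := hev
      exact ⟨X, by linarith⟩
    rw [hX] at hd
    have hm2 : 0 < m ^ 2 := by positivity
    have hν2 : 0 < ν ^ 2 := by positivity
    have hXY : X * (X + (m ^ 2 + 2 * ν ^ 2)) = 3 * ν ^ 4 := by linarith
    have hY0 : 0 < X + (m ^ 2 + 2 * ν ^ 2) := by linarith [abs_nonneg d]
    have hX0 : 0 < X := by
      have : 0 < X * (X + (m ^ 2 + 2 * ν ^ 2)) := by rw [hXY]; positivity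
      exact pos_of_mul_pos_left this hY0.le
    have hcXY : IsCoprime X (X + (m ^ 2 + 2 * ν ^ 2)) := by
      refine isCoprime_of_prime_dvd (fun h => hX0.ne' h.1) fun r hr hrX hrY => ?_
      have hrs : r ∣ m ^ 2 + 2 * ν ^ 2 := (dvd_add_right hrX).1 hrY
      have hrν : IsCoprime r ν := by
        refine (hr.coprime_iff_not_dvd).2 fun hrν => ?_
        have hrm : r ∣ m ^ 2 :=
          (dvd_add_left ((dvd_pow hrν two_ne_zero).mul_left 2)).1 hrs
        exact hr.not_isUnit (hmν.isUnit_of_dvd' (hr.dvd_of_dvd_pow hrm) hrν)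
      have hrr : r * r ∣ 3 * ν ^ 4 := hXY ▸ mul_dvd_mul hrX hrY
      have := ((hrν.mul_left hrν).pow_right (n := 4)).dvd_of_dvd_mul_right hrr
      exact hr.not_isUnit (Int.prime_three.irreducible.squarefree r this)
    have hcase : ∀ x y : ℤ, 0 < x → 0 < y → IsCoprime x y → x * y = ν ^ 4 →
        (m ^ 2 = 3 * x - y - 2 * ν ^ 2 ∨ m ^ 2 = y - 3 * x - 2 * ν ^ 2) → False := by
      intro x y hx hy hxy hxyν hs
      obtain ⟨g, h, e, hgh, hg⟩ : ∃ g h, ν ^ 2 = g ^ 2 * h ^ 2 ∧ IsCoprime g h ∧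
          x = h ^ 4 ∧ y = g ^ 4 := by
        obtain ⟨g, h, h1, h2, ⟨h3, h4⟩ | ⟨h3, h4⟩⟩ := factor_sq_mul_pow_four (c := 1) (e := ν)
          (Or.inl rfl) one_pos hx hy hxy (by rw [hxyν]; ring)
        · exact ⟨h, g, by rw [h1]; ring, by simpa using h2.symm, by linarith, h4⟩
        · exact ⟨g, h, h1, by simpa using h2, h3, by linarith⟩
      obtain ⟨rfl, rfl⟩ := hg
      have hg0 : g ≠ 0 := by rintro rfl; simp at hy
      have hh0 : h ≠ 0 := by rintro rfl; simp at hx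
      rcases hs with hs | hs
      · have hs' : m ^ 2 = (3 * h ^ 2 + g ^ 2) * (h ^ 2 - g ^ 2) := by rw [hs, e]; ring
        have hco := isCoprime_of_four_combination hmo (hgh.symm.pow (m := 2) (n := 2)) hs'
          1 1 1 (-3)
          (by ring) (by ring)
        obtain ⟨A, B, -, -, ⟨hA, hB⟩ | ⟨hA, hB⟩⟩ := sq_or_neg_sq_of_isCoprime hco hm0 hs'
        · have hmAB : m ^ 2 = (A * B) ^ 2 := by rw [hs', hA, hB]; ring
          have hABo : ¬ Even (A * B) := fun he => by
            have : Even (m ^ 2) := by rw [hmAB]; exact he.pow_of_ne_zero two_ne_zero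
            exact hmo ((Int.even_pow' two_ne_zero).1 this)
          have hA' := congrArg (Int.cast : ℤ → ZMod 4) hA
          have hB' := congrArg (Int.cast : ℤ → ZMod 4) hB
          push_cast at hA' hB'
          have : ∀ g h A B : ZMod 4, 3 * h ^ 2 + g ^ 2 = A ^ 2 → h ^ 2 - g ^ 2 = B ^ 2 →
              2 * (A * B) = 0 := by decide
          exact hABo (even_of_forall_zmod_four (by push_cast; exact this _ _ _ _ hA' hB'))
        · have : 0 < 3 * h ^ 2 + g ^ 2 := by positivity
          nlinarith [sq_nonneg A]
      · have hs' : m ^ 2 = (g ^ 2 - 3 * h ^ 2) * (g ^ 2 + h ^ 2) := by rw [hs, e]; ring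
        have hco := isCoprime_of_four_combination hmo (hgh.pow (m := 2) (n := 2)) hs' 1 3 (-1) 1
          (by ring) (by ring)
        obtain ⟨A, B, -, -, ⟨hA, hB⟩ | ⟨hA, hB⟩⟩ := sq_or_neg_sq_of_isCoprime hco hm0 hs'
        · have hcB : IsCoprime h B := by
            have : IsCoprime (h ^ 2) (B ^ 2) :=
              (hgh.symm.pow (m := 2) (n := 2)).of_lin_comb 1 0 (-1) 1 (by ring) (by linarith)
            exact (IsCoprime.pow_iff two_pos two_pos).1 this
          exact ih h.natAbs (hlt g h hg0 hh0 e) hh0 hcB (d := g) (c := A)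
            (by linarith) (by linarith) rfl
        · have : 0 < g ^ 2 + h ^ 2 := by positivity
          nlinarith [sq_nonneg B]
    rcases exists_eq_mul_of_mul_eq (Or.inr Int.prime_three) hXY with ⟨Z, hZ, hZY⟩ | ⟨Z, hZ, hZY⟩
    · refine hcase Z (X + (m ^ 2 + 2 * ν ^ 2)) (by linarith) hY0 ?_ hZY (Or.inr (by linarith))
      exact hcXY.of_isCoprime_of_dvd_left ⟨3, by rw [hZ]; ring⟩
    · refine hcase Z X (by linarith) hX0 ?_ (by rw [mul_comm]; exact hZY) (Or.inl (by linarith))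
      exact (hcXY.of_isCoprime_of_dvd_right ⟨3, by rw [hZ]; ring⟩).symm
  have hev : Even (m ^ 2 * n' ^ 2) := by
    obtain ⟨a, rfl⟩ := hαe
    have : m ^ 2 * n' ^ 2 = 2 * (2 * a ^ 2) := by linarith
    rw [this]; exact even_two_mul _
  rcases Int.even_mul.1 hev with he | he
  · exact key n' m (Int.even_pow.1 he).1 hmn.symm (by linarith) (by rw [hb]; ring)
  · exact key m n' (Int.even_pow.1 he).1 hmn hk hb

theorem Int.exists_squarefree_mul_sq {n : ℤ} (hn : n ≠ 0) :
    ∃ s x : ℤ, Squarefree s ∧ x ≠ 0 ∧ n = s * x ^ 2 := by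
  obtain ⟨s, x, h, hs⟩ := Nat.sq_mul_squarefree n.natAbs
  have hx : (x : ℤ) ≠ 0 := by
    rintro h0
    have : x = 0 := by exact_mod_cast h0
    subst this
    exact hn (Int.natAbs_eq_zero.1 (by rw [← h]; simp))
  have h' : (n.natAbs : ℤ) = s * x ^ 2 := by rw [← h]; push_cast; ring
  have hs' : Squarefree (s : ℤ) := Int.squarefree_natCast.2 hs
  rcases Int.natAbs_eq n with e | e
  · exact ⟨s, x, hs', hx, by rw [e, h']⟩
  · refine ⟨-s, x, ?_, hx, by rw [e, h']; ring⟩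
    rwa [← Int.squarefree_natAbs, Int.natAbs_neg, Int.squarefree_natAbs]

theorem Int.exists_mul_prod_eq_sq {ι : Type*} [Fintype ι] {s x : ι → ℤ} {c Y : ℤ}
    (hx : ∀ i, x i ≠ 0) (h : c * ∏ i, s i * x i ^ 2 = Y ^ 2) : ∃ T, c * ∏ i, s i = T ^ 2 := by
  rw [Finset.prod_mul_distrib, Finset.prod_pow, ← mul_assoc] at h
  have hX : (∏ i, x i) ≠ 0 := Finset.prod_ne_zero_iff.2 fun i _ => hx i
  have hdvd : (∏ i, x i) ∣ Y := by
    rw [← Int.pow_dvd_pow_iff two_ne_zero, ← h]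
    exact dvd_mul_left _ _
  obtain ⟨T, rfl⟩ := hdvd
  refine ⟨T, mul_right_cancel₀ (pow_ne_zero 2 hX) ?_⟩
  rw [h]; ring

/-- If a product of squarefree numbers and a constant `c` is a square, then every
prime not dividing `c` and dividing one of them divides another one. -/
theorem Int.exists_ne_dvd_of_mul_prod_eq_sq {ι : Type*} [Fintype ι] [DecidableEq ι] {s : ι → ℤ}
    {c T : ℤ} (hs : ∀ i, Squarefree (s i)) (h : c * ∏ i, s i = T ^ 2) {q : ℤ} (hq : Prime q)
    (hqc : ¬ q ∣ c) {j : ι} (hj : q ∣ s j) : ∃ i, i ≠ j ∧ q ∣ s i := by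
  by_contra! hne
  have hT : s j * (c * ∏ i ∈ Finset.univ.erase j, s i) = T ^ 2 := by
    rw [← h, ← Finset.mul_prod_erase _ _ (Finset.mem_univ j)]
    ring
  have hqT : q ∣ T := hq.dvd_of_dvd_pow (hT ▸ hj.mul_right _)
  have hqq : q * q ∣ s j * (c * ∏ i ∈ Finset.univ.erase j, s i) := by
    rw [hT, pow_two]; exact mul_dvd_mul hqT hqT
  have hcop : IsCoprime q (c * ∏ i ∈ Finset.univ.erase j, s i) := by
    refine hq.coprime_iff_not_dvd.2 fun hd => ?_
    rcases hq.dvd_or_dvd hd with hd | hd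
    · exact hqc hd
    · obtain ⟨i, hi, hd⟩ := (Prime.dvd_finsetProd_iff hq _).1 hd
      exact hne i (Finset.ne_of_mem_erase hi) hd
  exact hq.not_isUnit (hs j q ((hcop.mul_left hcop).dvd_of_dvd_mul_right hqq))

theorem Int.eq_mul_of_squarefree {p : ℕ} (hp : p.Prime) (hp2 : p ≠ 2) (hp3 : p ≠ 3) {s : ℤ}
    (hs : Squarefree s) (h : ∀ q : ℕ, q.Prime → (q : ℤ) ∣ s → q = 2 ∨ q = 3 ∨ q = p) :
    ∃ d : ℤ, (d ∣ 6) ∧ (s = d ∨ s = d * p) := by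
  have hn : s.natAbs ∣ 6 * p := by
    rw [← Nat.prod_primeFactors_of_squarefree (Int.squarefree_natAbs.2 hs)]
    have hsub : s.natAbs.primeFactors ⊆ {2, 3, p} := fun q hq => by
      have := h q (Nat.prime_of_mem_primeFactors hq)
        (Int.natCast_dvd.2 (Nat.dvd_of_mem_primeFactors hq))
      simpa using this
    have := Finset.prod_dvd_prod_of_subset _ _ (fun q => q) hsub
    rwa [Finset.prod_insert (by simp [hp2.symm]), Finset.prod_insert (by simp [hp3.symm]),
      Finset.prod_singleton, ← mul_assoc] at this
  obtain ⟨g, k, hg, hk, e⟩ := (Nat.dvd_mul).1 hn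
  have hg' : (g : ℤ) ∣ 6 := by exact_mod_cast hg
  rcases (Nat.dvd_prime hp).1 hk with rfl | rfl <;> rcases Int.natAbs_eq s with hs | hs
  · exact ⟨g, hg', Or.inl (by rw [hs, ← e]; simp)⟩
  · exact ⟨-g, (neg_dvd).2 hg', Or.inl (by rw [hs, ← e]; simp)⟩
  · exact ⟨g, hg', Or.inr (by rw [hs, ← e]; simp)⟩
  · exact ⟨-g, (neg_dvd).2 hg', Or.inr (by rw [hs, ← e]; simp)⟩

/-- The binary linear forms whose product is the homogenized quintic
`b * a * (a ^ 2 - b ^ 2) * (a ^ 2 - 4 * b ^ 2)`. -/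
def linearForms (a b : ℤ) : Fin 6 → ℤ := ![b, a, a - b, a + b, a - 2 * b, a + 2 * b]

/-- The resultants of the pairs of linear forms in `linearForms`. -/
def linearFormsResultant (i j : Fin 6) : ℤ :=
  linearForms 1 0 i * linearForms 0 1 j - linearForms 1 0 j * linearForms 0 1 i

theorem dvd_linearFormsResultant {a b q : ℤ} (h : IsCoprime a b) {i j : Fin 6}
    (hi : q ∣ linearForms a b i) (hj : q ∣ linearForms a b j) : q ∣ linearFormsResultant i j := by
  have hlin : ∀ i, linearForms a b i = linearForms 1 0 i * a + linearForms 0 1 i * b := by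
    intro i; fin_cases i <;> simp [linearForms] <;> ring
  rw [hlin] at hi hj
  obtain ⟨u, v, huv⟩ := h
  obtain ⟨k, hk⟩ := dvd_sub (hi.mul_left (u * linearForms 0 1 j - v * linearForms 1 0 j))
    (hj.mul_left (u * linearForms 0 1 i - v * linearForms 1 0 i))
  refine ⟨k, ?_⟩
  rw [← hk, linearFormsResultant]
  linear_combination (linearForms 1 0 j * linearForms 0 1 i
    - linearForms 1 0 i * linearForms 0 1 j) * huv

theorem linearFormsResultant_dvd : ∀ {i j : Fin 6}, i ≠ j → linearFormsResultant i j ∣ 12 := by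
  decide

/-- The square classes of the values of the linear forms at a point of the curve. -/
theorem exists_squareClass_linearForms {p : ℕ} (hp : p.Prime) (hp2 : p ≠ 2) (hp3 : p ≠ 3)
    {a b Y : ℤ} (hab : IsCoprime a b) (h0 : ∀ i, linearForms a b i ≠ 0)
    (h : p * ∏ i, linearForms a b i = Y ^ 2) :
    ∃ d w : Fin 6 → ℤ, (∀ i, d i ∣ 6) ∧ (∀ i, linearForms a b i = d i * w i) ∧
      (∃ c, ∀ i, ∃ z, z ≠ 0 ∧ (w i = z ^ 2 ∨ i = c ∧ w i = p * z ^ 2)) ∧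
      (∃ Q T, Odd Q ∧ Q * ∏ i, d i = T ^ 2) ∧
      (∀ j, 2 ∣ d j → ∃ i, i ≠ j ∧ 2 ∣ d i) ∧ ∀ j, 3 ∣ d j → ∃ i, i ≠ j ∧ 3 ∣ d i := by
  choose s x hs hx e using fun i => Int.exists_squarefree_mul_sq (h0 i)
  have h' : p * ∏ i, s i * x i ^ 2 = Y ^ 2 := by
    rw [← h]; congr 1; exact Finset.prod_congr rfl fun i _ => (e i).symm
  obtain ⟨T, hT⟩ := Int.exists_mul_prod_eq_sq hx h'
  have hpp := Nat.prime_iff_prime_int.1 hp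
  have hnd : ∀ q : ℕ, q.Prime → q ≠ p → ¬ (q : ℤ) ∣ p := fun q hq hqp hd =>
    hqp ((Nat.prime_dvd_prime_iff_eq hq hp).1 (Int.natCast_dvd_natCast.1 hd))
  have hdF : ∀ {q : ℤ} {i}, q ∣ s i → q ∣ linearForms a b i := fun {q i} hd => by
    rw [e i]; exact hd.mul_right _
  have h12 : ∀ {q : ℕ} {i j}, q.Prime → i ≠ j → (q : ℤ) ∣ linearForms a b i →
      (q : ℤ) ∣ linearForms a b j → q = 2 ∨ q = 3 := by
    intro q i j hq hij hi hj
    have hd : (q : ℤ) ∣ (12 : ℕ) := by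
      exact_mod_cast (dvd_linearFormsResultant hab hi hj).trans (linearFormsResultant_dvd hij)
    have hd' : q ∣ 2 * 2 * 3 := Int.natCast_dvd_natCast.1 hd
    rcases hq.dvd_mul.1 hd' with hd | hd
    · left
      rcases hq.dvd_mul.1 hd with hd | hd <;>
        exact (Nat.prime_dvd_prime_iff_eq hq Nat.prime_two).1 hd
    · right; exact (Nat.prime_dvd_prime_iff_eq hq Nat.prime_three).1 hd
  have hsp : ∀ i, ∃ d : ℤ, (d ∣ 6) ∧ (s i = d ∨ s i = d * p) := fun i => by
    refine Int.eq_mul_of_squarefree hp hp2 hp3 (hs i) fun q hq hqs => ?_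
    by_cases hqp : q = p
    · exact Or.inr (Or.inr hqp)
    · obtain ⟨j, hj, hqj⟩ := Int.exists_ne_dvd_of_mul_prod_eq_sq hs hT
        (Nat.prime_iff_prime_int.1 hq) (hnd q hq hqp) hqs
      rcases h12 hq hj (hdF hqj) (hdF hqs) with h | h
      · exact Or.inl h
      · exact Or.inr (Or.inl h)
  choose d hd hds using hsp
  have hdvd : ∀ q : ℕ, q.Prime → q ≠ p → ∀ i, ((q : ℤ) ∣ s i ↔ (q : ℤ) ∣ d i) := by
    intro q hq hqp i
    rcases hds i with h | h
    · rw [h]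
    · rw [h]
      exact ⟨fun hd => ((Nat.prime_iff_prime_int.1 hq).dvd_or_dvd hd).resolve_right
        (hnd q hq hqp), fun hd => hd.mul_right _⟩
  have hpar : ∀ q : ℕ, q.Prime → q ≠ p → ∀ j, (q : ℤ) ∣ d j → ∃ i, i ≠ j ∧ (q : ℤ) ∣ d i := by
    intro q hq hqp j hj
    obtain ⟨i, hi, hqi⟩ := Int.exists_ne_dvd_of_mul_prod_eq_sq hs hT
      (Nat.prime_iff_prime_int.1 hq) (hnd q hq hqp) ((hdvd q hq hqp j).2 hj)
    exact ⟨i, hi, (hdvd q hq hqp i).1 hqi⟩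
  obtain ⟨c, hc⟩ : ∃ c, ∀ i, (p : ℤ) ∣ s i → i = c := by
    by_cases hex : ∃ c, (p : ℤ) ∣ s c
    · obtain ⟨c, hc⟩ := hex
      refine ⟨c, fun i hi => ?_⟩
      by_contra hic
      rcases h12 hp hic (hdF hi) (hdF hc) with h | h
      · exact hp2 h
      · exact hp3 h
    · exact ⟨0, fun i hi => (hex ⟨i, hi⟩).elim⟩
  have hw : ∀ i, ∃ w, linearForms a b i = d i * w ∧
      ∃ z, z ≠ 0 ∧ (w = z ^ 2 ∨ i = c ∧ w = p * z ^ 2) := fun i => by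
    rcases hds i with h | h
    · exact ⟨x i ^ 2, by rw [e i, h], x i, hx i, Or.inl rfl⟩
    · exact ⟨p * x i ^ 2, by rw [e i, h]; ring, x i, hx i,
      Or.inr ⟨hc i (h ▸ dvd_mul_left _ _), rfl⟩⟩
  choose w hw1 hw2 using hw
  have hpo : Odd (p : ℤ) := by exact_mod_cast hp.odd_of_ne_two hp2
  have hodd : ∀ i, ∃ r : ℤ, Odd r ∧ s i = r * d i := fun i => by
    rcases hds i with h | h
    · exact ⟨1, odd_one, by rw [h, one_mul]⟩
    · exact ⟨p, hpo, by rw [h, mul_comm]⟩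
  choose r hro hsr using hodd
  have hQ : Odd ((p : ℤ) * ∏ i, r i) :=
    hpo.mul (Finset.prod_induction r Odd (fun _ _ => Odd.mul) odd_one fun i _ => hro i)
  refine ⟨d, w, hd, hw1, ⟨c, hw2⟩, ⟨_, T, hQ, ?_⟩, hpar 2 Nat.prime_two hp2.symm,
    hpar 3 Nat.prime_three hp3.symm⟩
  rw [← hT, mul_assoc, ← Finset.prod_mul_distrib, Finset.prod_congr rfl fun i _ => hsr i]

theorem Int.exists_eq_mul_of_dvd_six {d : ℤ} (h : d ∣ 6) : ∃ ε τ θ : ℤ, (ε = 1 ∨ ε = -1) ∧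
    (τ = 1 ∨ τ = 2) ∧ (θ = 1 ∨ θ = 3) ∧ d = ε * τ * θ := by
  have h1 := Int.le_of_dvd (by norm_num) h
  have h2 := Int.le_of_dvd (by norm_num) ((neg_dvd).2 h)
  have h3 : -6 ≤ d := by omega
  interval_cases d
  all_goals first
    | exact ⟨1, 1, 1, by decide⟩ | exact ⟨1, 1, 3, by decide⟩
    | exact ⟨1, 2, 1, by decide⟩ | exact ⟨1, 2, 3, by decide⟩
    | exact ⟨-1, 1, 1, by decide⟩ | exact ⟨-1, 1, 3, by decide⟩
    | exact ⟨-1, 2, 1, by decide⟩ | exact ⟨-1, 2, 3, by decide⟩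
    | exact absurd h (by decide)

theorem Int.emod_of_eq_sq {w z : ℤ} (h : w = z ^ 2) : w % 8 = 1 ∨ w % 32 = 4 ∨ w % 16 = 0 := by
  have hr : ∀ r : ZMod 32, (r ^ 2).val % 8 = 1 ∨ (r ^ 2).val = 4 ∨ (r ^ 2).val % 16 = 0 := by decide
  have := hr (z : ZMod 32)
  have e : (((z : ZMod 32) ^ 2).val : ℤ) = w % 32 := by
    rw [← Int.cast_pow, ← h, ZMod.val_intCast]; rfl
  omega

theorem Int.emod_of_eq_mul_sq {p w z : ℤ} (hp : p % 8 = 1) (h : w = p * z ^ 2) :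
    w % 8 = 1 ∨ w % 32 = 4 ∨ w % 16 = 0 := by
  obtain ⟨k, rfl⟩ : ∃ k, p = 8 * k + 1 := ⟨p / 8, by omega⟩
  rcases Int.even_or_odd' z with ⟨j, rfl | rfl⟩
  · rcases Int.even_or_odd' j with ⟨i, rfl | rfl⟩
    · right; right
      have : w = 16 * ((8 * k + 1) * i ^ 2) := by rw [h]; ring
      omega
    · right; left
      obtain ⟨t, ht⟩ := Int.even_mul_succ_self i
      have : w = 32 * (k * (2 * i + 1) ^ 2) + 16 * (i * (i + 1)) + 4 := by rw [h]; ring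
      omega
  · left
    obtain ⟨t, ht⟩ := Int.even_mul_succ_self j
    have : w = 8 * (k * (2 * j + 1) ^ 2) + 4 * (j * (j + 1)) + 1 := by rw [h]; ring
    omega

/-- The sign vectors of the linear forms in the three components of the positive locus. -/
theorem sign_linearForms {a b : ℤ} (hb : 0 < b) (h : 0 < ∏ i, linearForms a b i) :
    0 < a - 2 * b ∨ (a - b < 0 ∧ 0 < a) ∨ (a + b < 0 ∧ 0 < a + 2 * b) := by
  have h1 : 0 < a * ((a - b) * (a + b)) * ((a - 2 * b) * (a + 2 * b)) := by
    refine (mul_pos_iff_of_pos_left hb).1 ?_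
    have e : ∏ i, linearForms a b i =
      b * (a * ((a - b) * (a + b)) * ((a - 2 * b) * (a + 2 * b))) := by
      simp [Fin.prod_univ_six, linearForms]
      ring
    rwa [← e]
  by_contra! hcon
  obtain ⟨c1, c2, c3⟩ := hcon
  refine absurd h1 (not_lt.2 ?_)
  rcases le_or_gt 0 (a - b) with h2 | h2
  · exact mul_nonpos_of_nonneg_of_nonpos (mul_nonneg (by omega) (mul_nonneg h2 (by omega)))
      (mul_nonpos_of_nonpos_of_nonneg c1 (by omega))
  · have ha := c2 h2
    rcases le_or_gt 0 (a + b) with h3 | h3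
    · exact mul_nonpos_of_nonneg_of_nonpos
        (mul_nonneg_of_nonpos_of_nonpos ha (mul_nonpos_of_nonpos_of_nonneg h2.le h3))
        (mul_nonpos_of_nonpos_of_nonneg c1 (by omega))
    · exact mul_nonpos_of_nonpos_of_nonneg
        (mul_nonpos_of_nonpos_of_nonneg ha (mul_nonneg_of_nonpos_of_nonpos h2.le h3.le))
        (mul_nonneg_of_nonpos_of_nonpos c1 (c3 h3))

theorem squareClass_of_right_even {a b ε₁ ε₂ ε₃ ε₄ ε₅ θ₂ θ₃ θ₄ θ₅ w₁ w₂ w₃ w₄ w₅ : ℤ}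
    (hε : (ε₁ = 1 ∧ ε₂ = 1 ∧ ε₃ = 1 ∧ ε₄ = 1 ∧ ε₅ = 1) ∨
      (ε₁ = 1 ∧ ε₂ = -1 ∧ ε₃ = 1 ∧ ε₄ = -1 ∧ ε₅ = 1) ∨
      (ε₁ = -1 ∧ ε₂ = -1 ∧ ε₃ = -1 ∧ ε₄ = -1 ∧ ε₅ = 1))
    (hθ : (θ₂ = 1 ∧ θ₃ = 1 ∧ θ₄ = 1 ∧ θ₅ = 1) ∨ (θ₂ = 3 ∧ θ₃ = 1 ∧ θ₄ = 1 ∧ θ₅ = 3) ∨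
      (θ₂ = 1 ∧ θ₃ = 3 ∧ θ₄ = 3 ∧ θ₅ = 1))
    (h1 : w₁ % 8 = 1) (h2 : w₂ % 8 = 1)
    (h3 : w₃ % 8 = 1) (h4 : w₄ % 8 = 1) (h5 : w₅ % 8 = 1) (hb : b % 2 = 0)
    (e1 : a = ε₁ * w₁) (e2 : a - b = ε₂ * θ₂ * w₂) (e3 : a + b = ε₃ * θ₃ * w₃)
    (e4 : a - 2 * b = ε₄ * θ₄ * w₄) (e5 : a + 2 * b = ε₅ * θ₅ * w₅) :
    (ε₁ = 1 ∧ ε₂ = 1 ∧ ε₃ = 1 ∧ ε₄ = 1 ∧ ε₅ = 1) ∧ (θ₂ = 1 ∧ θ₃ = 1 ∧ θ₄ = 1 ∧ θ₅ = 1) := by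
  rcases hε with ⟨rfl, rfl, rfl, rfl, rfl⟩ | ⟨rfl, rfl, rfl, rfl, rfl⟩ |
      ⟨rfl, rfl, rfl, rfl, rfl⟩ <;>
    rcases hθ with ⟨rfl, rfl, rfl, rfl⟩ | ⟨rfl, rfl, rfl, rfl⟩ | ⟨rfl, rfl, rfl, rfl⟩ <;>
    first
    | decide
    | (exfalso; omega)

theorem squareClass_of_left_even
    {a b ε₁ ε₂ ε₃ ε₄ ε₅ τ₁ τ₄ τ₅ θ₂ θ₃ θ₄ θ₅ w₀ w₁ w₂ w₃ w₄ w₅ : ℤ}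
    (hε : (ε₁ = 1 ∧ ε₂ = 1 ∧ ε₃ = 1 ∧ ε₄ = 1 ∧ ε₅ = 1) ∨
      (ε₁ = 1 ∧ ε₂ = -1 ∧ ε₃ = 1 ∧ ε₄ = -1 ∧ ε₅ = 1) ∨
      (ε₁ = -1 ∧ ε₂ = -1 ∧ ε₃ = -1 ∧ ε₄ = -1 ∧ ε₅ = 1))
    (hθ : (θ₂ = 1 ∧ θ₃ = 1 ∧ θ₄ = 1 ∧ θ₅ = 1) ∨ (θ₂ = 3 ∧ θ₃ = 1 ∧ θ₄ = 1 ∧ θ₅ = 3) ∨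
      (θ₂ = 1 ∧ θ₃ = 3 ∧ θ₄ = 3 ∧ θ₅ = 1))
    (hτ : (τ₁ = 1 ∧ τ₄ = 1 ∧ τ₅ = 1) ∨ (τ₁ = 1 ∧ τ₄ = 2 ∧ τ₅ = 2) ∨
      (τ₁ = 2 ∧ τ₄ = 1 ∧ τ₅ = 2) ∨ (τ₁ = 2 ∧ τ₄ = 2 ∧ τ₅ = 1))
    (h0 : w₀ % 8 = 1) (h1 : w₁ % 8 = 1 ∨ w₁ % 32 = 4 ∨ w₁ % 16 = 0) (h2 : w₂ % 8 = 1)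
    (h3 : w₃ % 8 = 1) (h4 : w₄ % 8 = 1 ∨ w₄ % 32 = 4 ∨ w₄ % 16 = 0)
    (h5 : w₅ % 8 = 1 ∨ w₅ % 32 = 4 ∨ w₅ % 16 = 0) (ha : a % 2 = 0)
    (e0 : b = w₀) (e1 : a = ε₁ * τ₁ * w₁) (e2 : a - b = ε₂ * θ₂ * w₂) (e3 : a + b = ε₃ * θ₃ * w₃)
    (e4 : a - 2 * b = ε₄ * τ₄ * θ₄ * w₄) (e5 : a + 2 * b = ε₅ * τ₅ * θ₅ * w₅) :
    ((ε₁ = 1 ∧ ε₂ = -1 ∧ ε₃ = 1 ∧ ε₄ = -1 ∧ ε₅ = 1) ∧ (τ₁ = 1 ∧ τ₄ = 2 ∧ τ₅ = 2) ∧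
      (θ₂ = 1 ∧ θ₃ = 1 ∧ θ₄ = 1 ∧ θ₅ = 1)) ∨
    ((ε₁ = 1 ∧ ε₂ = 1 ∧ ε₃ = 1 ∧ ε₄ = 1 ∧ ε₅ = 1) ∧ (τ₁ = 2 ∧ τ₄ = 2 ∧ τ₅ = 1) ∧
      (θ₂ = 1 ∧ θ₃ = 3 ∧ θ₄ = 3 ∧ θ₅ = 1)) ∨
    ((ε₁ = -1 ∧ ε₂ = -1 ∧ ε₃ = -1 ∧ ε₄ = -1 ∧ ε₅ = 1) ∧ (τ₁ = 2 ∧ τ₄ = 1 ∧ τ₅ = 2) ∧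
      (θ₂ = 3 ∧ θ₃ = 1 ∧ θ₄ = 1 ∧ θ₅ = 3)) := by
  rcases hε with ⟨rfl, rfl, rfl, rfl, rfl⟩ | ⟨rfl, rfl, rfl, rfl, rfl⟩ |
      ⟨rfl, rfl, rfl, rfl, rfl⟩ <;>
    rcases hθ with ⟨rfl, rfl, rfl, rfl⟩ | ⟨rfl, rfl, rfl, rfl⟩ | ⟨rfl, rfl, rfl, rfl⟩ <;>
    rcases hτ with ⟨rfl, rfl, rfl⟩ | ⟨rfl, rfl, rfl⟩ | ⟨rfl, rfl, rfl⟩ | ⟨rfl, rfl, rfl⟩ <;>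
    first
    | decide
    | (exfalso; omega)

theorem squareClass_of_odd
    {a b ε₁ ε₂ ε₃ ε₄ ε₅ τ₂ τ₃ θ₂ θ₃ θ₄ θ₅ w₀ w₁ w₂ w₃ w₄ w₅ : ℤ}
    (hε : (ε₁ = 1 ∧ ε₂ = 1 ∧ ε₃ = 1 ∧ ε₄ = 1 ∧ ε₅ = 1) ∨
      (ε₁ = 1 ∧ ε₂ = -1 ∧ ε₃ = 1 ∧ ε₄ = -1 ∧ ε₅ = 1) ∨
      (ε₁ = -1 ∧ ε₂ = -1 ∧ ε₃ = -1 ∧ ε₄ = -1 ∧ ε₅ = 1))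
    (hθ : (θ₂ = 1 ∧ θ₃ = 1 ∧ θ₄ = 1 ∧ θ₅ = 1) ∨ (θ₂ = 3 ∧ θ₃ = 1 ∧ θ₄ = 1 ∧ θ₅ = 3) ∨
      (θ₂ = 1 ∧ θ₃ = 3 ∧ θ₄ = 3 ∧ θ₅ = 1))
    (hτ : (τ₂ = 1 ∧ τ₃ = 1) ∨ (τ₂ = 2 ∧ τ₃ = 2))
    (h0 : w₀ % 8 = 1) (h1 : w₁ % 8 = 1) (h2 : w₂ % 8 = 1 ∨ w₂ % 32 = 4 ∨ w₂ % 16 = 0)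
    (h3 : w₃ % 8 = 1 ∨ w₃ % 32 = 4 ∨ w₃ % 16 = 0) (h4 : w₄ % 8 = 1) (h5 : w₅ % 8 = 1)
    (e0 : b = w₀) (e1 : a = ε₁ * w₁) (e2 : a - b = ε₂ * τ₂ * θ₂ * w₂)
    (e3 : a + b = ε₃ * τ₃ * θ₃ * w₃) (e4 : a - 2 * b = ε₄ * θ₄ * w₄)
    (e5 : a + 2 * b = ε₅ * θ₅ * w₅) :
    (τ₂ = 2 ∧ τ₃ = 2) ∧
    (((ε₁ = 1 ∧ ε₂ = -1 ∧ ε₃ = 1 ∧ ε₄ = -1 ∧ ε₅ = 1) ∧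
      (θ₂ = 3 ∧ θ₃ = 1 ∧ θ₄ = 1 ∧ θ₅ = 3)) ∨
    ((ε₁ = -1 ∧ ε₂ = -1 ∧ ε₃ = -1 ∧ ε₄ = -1 ∧ ε₅ = 1) ∧
      (θ₂ = 1 ∧ θ₃ = 3 ∧ θ₄ = 3 ∧ θ₅ = 1))) := by
  rcases hε with ⟨rfl, rfl, rfl, rfl, rfl⟩ | ⟨rfl, rfl, rfl, rfl, rfl⟩ |
      ⟨rfl, rfl, rfl, rfl, rfl⟩ <;>
    rcases hθ with ⟨rfl, rfl, rfl, rfl⟩ | ⟨rfl, rfl, rfl, rfl⟩ | ⟨rfl, rfl, rfl, rfl⟩ <;>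
    rcases hτ with ⟨rfl, rfl⟩ | ⟨rfl, rfl⟩ <;>
    first
    | decide
    | (exfalso; omega)

set_option maxHeartbeats 800000 in
/-- The square classes modulo `⟨-1, 2, 3⟩` of the linear forms at a point of the curve are those
of one of its Weierstrass points. -/
theorem squareClass_linearForms {a b : ℤ} {d w : Fin 6 → ℤ} (hab : IsCoprime a b) (hb : 0 < b)
    (hpos : 0 < ∏ i, linearForms a b i) (hd : ∀ i, d i ∣ 6)
    (e : ∀ i, linearForms a b i = d i * w i) (hw0 : ∀ i, 0 < w i)
    (hw : ∀ i, w i % 8 = 1 ∨ w i % 32 = 4 ∨ w i % 16 = 0)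
    (hQ : ∃ Q T, Odd Q ∧ Q * ∏ i, d i = T ^ 2)
    (h2 : ∀ j, 2 ∣ d j → ∃ i, i ≠ j ∧ 2 ∣ d i) (h3 : ∀ j, 3 ∣ d j → ∃ i, i ≠ j ∧ 3 ∣ d i) :
    d = ![1, 1, 1, 1, 1, 1] ∨ d = ![1, 1, -1, 1, -2, 2] ∨ d = ![1, 1, -6, 2, -1, 3] ∨
      d = ![1, -1, -2, -6, -3, 1] ∨ d = ![1, 2, 1, 3, 6, 1] ∨ d = ![1, -2, -3, -1, -1, 6] := by
  have hr : ∀ {q : ℤ} {i j}, q ∣ d i → q ∣ d j → q ∣ linearFormsResultant i j := fun hi hj =>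
    dvd_linearFormsResultant hab (e _ ▸ hi.mul_right _) (e _ ▸ hj.mul_right _)
  choose ε τ θ hε hτ hθ hετθ using fun i => Int.exists_eq_mul_of_dvd_six (hd i)
  have hsgn : ∀ i, (0 < linearForms a b i → ε i = 1) ∧ (linearForms a b i < 0 → ε i = -1) := by
    intro i
    rw [e i, mul_pos_iff_of_pos_right (hw0 i), ← neg_pos, ← neg_mul, mul_pos_iff_of_pos_right (hw0 i),
      hετθ i]
    rcases hε i with h | h <;> rcases hτ i with h' | h' <;> rcases hθ i with h'' | h'' <;>
      rw [h, h', h''] <;> norm_num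
  have hd2 : ∀ i, 2 ∣ d i ↔ τ i = 2 := fun i => by
    rw [hετθ i]
    rcases hε i with h | h <;> rcases hτ i with h' | h' <;> rcases hθ i with h'' | h'' <;>
      rw [h, h', h''] <;> norm_num
  have hd3 : ∀ i, 3 ∣ d i ↔ θ i = 3 := fun i => by
    rw [hετθ i]
    rcases hε i with h | h <;> rcases hτ i with h' | h' <;> rcases hθ i with h'' | h'' <;>
      rw [h, h', h''] <;> norm_num
  have hodd : ∀ i, ¬ 2 ∣ linearForms a b i → w i % 8 = 1 ∧ τ i = 1 := fun i hi => by
    have hw2 : ¬ 2 ∣ w i := fun h => hi (e i ▸ h.mul_left _)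
    have hd2' : ¬ 2 ∣ d i := fun h => hi (e i ▸ h.mul_right _)
    rw [hd2] at hd2'
    exact ⟨by rcases hw i with h | h | h <;> omega, (hτ i).resolve_right hd2'⟩
  have hθpat : (θ 0 = 1 ∧ θ 1 = 1) ∧ ((θ 2 = 1 ∧ θ 3 = 1 ∧ θ 4 = 1 ∧ θ 5 = 1) ∨
      (θ 2 = 3 ∧ θ 3 = 1 ∧ θ 4 = 1 ∧ θ 5 = 3) ∨ (θ 2 = 1 ∧ θ 3 = 3 ∧ θ 4 = 3 ∧ θ 5 = 1)) := by
    simp only [hd3] at h3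
    have hp : ∀ j i : Fin 6, i ≠ j → 3 ∣ linearFormsResultant i j →
        (j = 2 ∧ i = 5) ∨ (j = 5 ∧ i = 2) ∨ (j = 3 ∧ i = 4) ∨ (j = 4 ∧ i = 3) := by decide
    have hp' : ∀ j, θ j = 3 → (j = 2 ∧ θ 5 = 3) ∨ (j = 5 ∧ θ 2 = 3) ∨ (j = 3 ∧ θ 4 = 3) ∨
        (j = 4 ∧ θ 3 = 3) := fun j hj => by
      obtain ⟨i, hij, hi⟩ := h3 j hj
      rcases hp j i hij (hr ((hd3 i).2 hi) ((hd3 j).2 hj)) with ⟨rfl, rfl⟩ | ⟨rfl, rfl⟩ |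
        ⟨rfl, rfl⟩ | ⟨rfl, rfl⟩ <;> simp [hi]
    have h23 : ¬ (θ 2 = 3 ∧ θ 3 = 3) := fun ⟨h, h'⟩ =>
      absurd (hr ((hd3 2).2 h) ((hd3 3).2 h')) (by decide)
    have q0 := hp' 0
    have q1 := hp' 1
    have q2 := hp' 2
    have q3 := hp' 3
    have q4 := hp' 4
    have q5 := hp' 5
    simp at q0 q1 q2 q3 q4 q5
    have r0 := hθ 0
    have r1 := hθ 1
    have r2 := hθ 2
    have r3 := hθ 3
    have r4 := hθ 4
    have r5 := hθ 5
    omega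
  have hεpat : ε 0 = 1 ∧ ((ε 1 = 1 ∧ ε 2 = 1 ∧ ε 3 = 1 ∧ ε 4 = 1 ∧ ε 5 = 1) ∨
      (ε 1 = 1 ∧ ε 2 = -1 ∧ ε 3 = 1 ∧ ε 4 = -1 ∧ ε 5 = 1) ∨
      (ε 1 = -1 ∧ ε 2 = -1 ∧ ε 3 = -1 ∧ ε 4 = -1 ∧ ε 5 = 1)) := by
    have s0 := hsgn 0
    have s1 := hsgn 1
    have s2 := hsgn 2
    have s3 := hsgn 3
    have s4 := hsgn 4
    have s5 := hsgn 5
    simp only [linearForms, Matrix.cons_val] at s0 s1 s2 s3 s4 s5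
    refine ⟨s0.1 hb, ?_⟩
    rcases sign_linearForms hb hpos with h | ⟨h, h'⟩ | ⟨h, h'⟩
    · exact Or.inl ⟨s1.1 (by linarith), s2.1 (by linarith), s3.1 (by linarith), s4.1 (by linarith),
        s5.1 (by linarith)⟩
    · exact Or.inr (Or.inl ⟨s1.1 (by linarith), s2.2 (by linarith), s3.1 (by linarith),
        s4.2 (by linarith), s5.1 (by linarith)⟩)
    · exact Or.inr (Or.inr ⟨s1.2 (by linarith), s2.2 (by linarith), s3.2 (by linarith),
        s4.2 (by linarith), s5.1 (by linarith)⟩)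
  simp only [hd2] at h2
  have hτpat : ∀ j, τ j = 2 → (∀ i, i ≠ j → τ i = 1) → False := fun j hj h => by
    obtain ⟨i, hij, hi⟩ := h2 j hj
    rw [h i hij] at hi
    norm_num at hi
  have hτodd : ¬ (τ 0 = 1 ∧ τ 1 = 2 ∧ τ 2 = 1 ∧ τ 3 = 1 ∧ τ 4 = 2 ∧ τ 5 = 2) := by
    rintro ⟨k0, k1, k2, k3, k4, k5⟩
    obtain ⟨Q, T, hQ, hT⟩ := hQ
    have hN : Odd (∏ i, ε i * θ i) :=
      Finset.prod_induction (fun i => ε i * θ i) Odd (fun _ _ => Odd.mul) odd_one fun i _ => by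
        rcases hε i with h | h <;> rcases hθ i with h' | h' <;> rw [h, h'] <;> decide
    have hd8 : ∏ i, d i = 8 * ∏ i, ε i * θ i := by
      rw [Finset.prod_congr rfl fun i _ => (hετθ i).trans
        (show ε i * τ i * θ i = τ i * (ε i * θ i) by ring), Finset.prod_mul_distrib]
      congr 1
      rw [Fin.prod_univ_six, k0, k1, k2, k3, k4, k5]
      norm_num
    obtain ⟨N, hN⟩ := hQ.mul hN
    have hT8 : T ^ 2 = 8 * (2 * N + 1) := by rw [← hT, hd8, ← hN]; ring
    have hT' := congrArg (Int.cast : ℤ → ZMod 16) hT8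
    push_cast at hT'
    have : ∀ T N : ZMod 16, T ^ 2 ≠ 8 * (2 * N + 1) := by decide
    exact this _ _ hT'
  simp only [hετθ] at e
  have e0 := e 0
  have e1 := e 1
  have e2 := e 2
  have e3 := e 3
  have e4 := e 4
  have e5 := e 5
  have o0 := hodd 0
  have o1 := hodd 1
  have o2 := hodd 2
  have o3 := hodd 3
  have o4 := hodd 4
  have o5 := hodd 5
  have u0 := hτ 0
  have u1 := hτ 1
  have u2 := hτ 2
  have u3 := hτ 3
  have u4 := hτ 4
  have u5 := hτ 5
  have hF0 : linearForms a b 0 = b := rfl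
  have hF1 : linearForms a b 1 = a := rfl
  have hF2 : linearForms a b 2 = a - b := rfl
  have hF3 : linearForms a b 3 = a + b := rfl
  have hF4 : linearForms a b 4 = a - 2 * b := rfl
  have hF5 : linearForms a b 5 = a + 2 * b := rfl
  rw [hF0] at e0 o0
  rw [hF1] at e1 o1
  rw [hF2] at e2 o2
  rw [hF3] at e3 o3
  rw [hF4] at e4 o4
  rw [hF5] at e5 o5
  obtain ⟨⟨θ0, θ1⟩, hθpat⟩ := hθpat
  obtain ⟨ε0, hεpat⟩ := hεpat
  have hdeq : ∀ v : Fin 6 → ℤ, (ε 0 * τ 0 * θ 0 = v 0 ∧ ε 1 * τ 1 * θ 1 = v 1 ∧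
      ε 2 * τ 2 * θ 2 = v 2 ∧ ε 3 * τ 3 * θ 3 = v 3 ∧ ε 4 * τ 4 * θ 4 = v 4 ∧
      ε 5 * τ 5 * θ 5 = v 5) → d = v := by
    rintro v ⟨v0, v1, v2, v3, v4, v5⟩
    funext i
    rw [hετθ i]
    fin_cases i <;> assumption
  rcases Int.even_or_odd b with hbp | hbp
  · have ha2 : ¬ 2 ∣ a := fun h =>
      Int.prime_two.not_isUnit (hab.isUnit_of_dvd' h hbp.two_dvd)
    have hb2 := hbp.two_dvd
    obtain ⟨o1, τ1⟩ := o1 ha2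
    obtain ⟨o2, τ2⟩ := o2 (by omega)
    obtain ⟨o3, τ3⟩ := o3 (by omega)
    obtain ⟨o4, τ4⟩ := o4 (by omega)
    obtain ⟨o5, τ5⟩ := o5 (by omega)
    have τ0 : τ 0 = 1 := u0.resolve_right fun h => hτpat 0 h fun i hi => by
      fin_cases i <;> first | assumption | exact absurd rfl hi
    simp only [ε0, θ0, θ1, τ0, τ1, τ2, τ3, τ4, τ5, one_mul, mul_one] at e0 e1 e2 e3 e4 e5
    obtain ⟨⟨ε1, ε2, ε3, ε4, ε5⟩, θ2, θ3, θ4, θ5⟩ := squareClass_of_right_even hεpat hθpat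
      o1 o2 o3 o4 o5 (by omega) e1 e2 e3 e4 e5
    refine Or.inl (hdeq _ ?_)
    rw [ε0, ε1, ε2, ε3, ε4, ε5, τ0, τ1, τ2, τ3, τ4, τ5, θ0, θ1, θ2, θ3, θ4, θ5]
    decide
  · have hb2 : ¬ 2 ∣ b := by rw [← even_iff_two_dvd, Int.not_even_iff_odd]; exact hbp
    obtain ⟨o0, τ0⟩ := o0 hb2
    rcases Int.even_or_odd a with hap | hap
    · have ha2 := hap.two_dvd
      obtain ⟨o2, τ2⟩ := o2 (by omega)
      obtain ⟨o3, τ3⟩ := o3 (by omega)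
      have hτ' : (τ 1 = 1 ∧ τ 4 = 1 ∧ τ 5 = 1) ∨ (τ 1 = 1 ∧ τ 4 = 2 ∧ τ 5 = 2) ∨
          (τ 1 = 2 ∧ τ 4 = 1 ∧ τ 5 = 2) ∨ (τ 1 = 2 ∧ τ 4 = 2 ∧ τ 5 = 1) := by
        rcases u1 with h1 | h1 <;> rcases u4 with h4 | h4 <;> rcases u5 with h5 | h5
        · exact Or.inl ⟨h1, h4, h5⟩
        · exact (hτpat 5 h5 fun i hi => by
            fin_cases i <;> first | assumption | exact absurd rfl hi).elim
        · exact (hτpat 4 h4 fun i hi => by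
            fin_cases i <;> first | assumption | exact absurd rfl hi).elim
        · exact Or.inr (Or.inl ⟨h1, h4, h5⟩)
        · exact (hτpat 1 h1 fun i hi => by
            fin_cases i <;> first | assumption | exact absurd rfl hi).elim
        · exact Or.inr (Or.inr (Or.inl ⟨h1, h4, h5⟩))
        · exact Or.inr (Or.inr (Or.inr ⟨h1, h4, h5⟩))
        · exact (hτodd ⟨τ0, h1, τ2, τ3, h4, h5⟩).elim
      simp only [ε0, θ0, θ1, τ0, τ2, τ3, one_mul, mul_one] at e0 e1 e2 e3 e4 e5
      obtain ⟨⟨ε1, ε2, ε3, ε4, ε5⟩, ⟨τ1, τ4, τ5⟩, θ2, θ3, θ4, θ5⟩ |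
        ⟨⟨ε1, ε2, ε3, ε4, ε5⟩, ⟨τ1, τ4, τ5⟩, θ2, θ3, θ4, θ5⟩ |
        ⟨⟨ε1, ε2, ε3, ε4, ε5⟩, ⟨τ1, τ4, τ5⟩, θ2, θ3, θ4, θ5⟩ :=
            squareClass_of_left_even hεpat hθpat hτ' o0 (hw 1) o2
          o3 (hw 4) (hw 5) (by omega) e0 e1 e2 e3 e4 e5
      · refine Or.inr (Or.inl (hdeq _ ?_))
        rw [ε0, ε1, ε2, ε3, ε4, ε5, τ0, τ1, τ2, τ3, τ4, τ5, θ0, θ1, θ2, θ3, θ4, θ5]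
        decide
      · refine Or.inr (Or.inr (Or.inr (Or.inr (Or.inl (hdeq _ ?_)))))
        rw [ε0, ε1, ε2, ε3, ε4, ε5, τ0, τ1, τ2, τ3, τ4, τ5, θ0, θ1, θ2, θ3, θ4, θ5]
        decide
      · refine Or.inr (Or.inr (Or.inr (Or.inr (Or.inr (hdeq _ ?_)))))
        rw [ε0, ε1, ε2, ε3, ε4, ε5, τ0, τ1, τ2, τ3, τ4, τ5, θ0, θ1, θ2, θ3, θ4, θ5]
        decide
    · have ha2 : ¬ 2 ∣ a := by rw [← even_iff_two_dvd, Int.not_even_iff_odd]; exact hap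
      obtain ⟨o1, τ1⟩ := o1 ha2
      obtain ⟨o4, τ4⟩ := o4 (by omega)
      obtain ⟨o5, τ5⟩ := o5 (by omega)
      have hτ' : (τ 2 = 1 ∧ τ 3 = 1) ∨ (τ 2 = 2 ∧ τ 3 = 2) := by
        rcases u2 with h2 | h2 <;> rcases u3 with h3 | h3
        · exact Or.inl ⟨h2, h3⟩
        · exact (hτpat 3 h3 fun i hi => by
            fin_cases i <;> first | assumption | exact absurd rfl hi).elim
        · exact (hτpat 2 h2 fun i hi => by
            fin_cases i <;> first | assumption | exact absurd rfl hi).elim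
        · exact Or.inr ⟨h2, h3⟩
      simp only [ε0, θ0, θ1, τ0, τ1, τ4, τ5, one_mul, mul_one] at e0 e1 e2 e3 e4 e5
      obtain ⟨⟨τ2, τ3⟩, ⟨⟨ε1, ε2, ε3, ε4, ε5⟩, θ2, θ3, θ4, θ5⟩ |
        ⟨⟨ε1, ε2, ε3, ε4, ε5⟩, θ2, θ3, θ4, θ5⟩⟩ :=
            squareClass_of_odd hεpat hθpat hτ' o0 o1 (hw 2) (hw 3)
          o4 o5 e0 e1 e2 e3 e4 e5
      · refine Or.inr (Or.inr (Or.inl (hdeq _ ?_)))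
        rw [ε0, ε1, ε2, ε3, ε4, ε5, τ0, τ1, τ2, τ3, τ4, τ5, θ0, θ1, θ2, θ3, θ4, θ5]
        decide
      · refine Or.inr (Or.inr (Or.inr (Or.inl (hdeq _ ?_))))
        rw [ε0, ε1, ε2, ε3, ε4, ε5, τ0, τ1, τ2, τ3, τ4, τ5, θ0, θ1, θ2, θ3, θ4, θ5]
        decide

theorem SquaresUpToTwist.of_forall {ι : Type*} {p : ℕ} {w : ι → ℤ}
    (hw : ∃ c, ∀ i, ∃ z, z ≠ 0 ∧ (w i = z ^ 2 ∨ i = c ∧ w i = p * z ^ 2)) {i j k l : ι}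
    (hij : i ≠ j) (hik : i ≠ k) (hil : i ≠ l) (hjk : j ≠ k) (hjl : j ≠ l) (hkl : k ≠ l) :
    SquaresUpToTwist p (w i) (w j) (w k) (w l) := by
  obtain ⟨c, hc⟩ := hw
  have hsq : ∀ i, i ≠ c → ∃ z, w i = z ^ 2 := fun i hi => by
    obtain ⟨z, -, h | ⟨h, -⟩⟩ := hc i
    · exact ⟨z, h⟩
    · exact (hi h).elim
  have hor : ∀ i, (∃ z, w i = z ^ 2) ∨ i = c ∧ ∃ z, w i = p * z ^ 2 := fun i => by
    obtain ⟨z, -, h | ⟨h, h'⟩⟩ := hc i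
    · exact Or.inl ⟨z, h⟩
    · exact Or.inr ⟨h, z, h'⟩
  rcases hor i with ⟨x, hx⟩ | ⟨rfl, x, hx⟩
  · rcases hor j with ⟨y, hy⟩ | ⟨rfl, y, hy⟩
    · rcases hor k with ⟨z, hz⟩ | ⟨rfl, z, hz⟩
      · rcases hor l with ⟨t, ht⟩ | ⟨rfl, t, ht⟩
        · exact Or.inl ⟨x, y, z, t, hx, hy, hz, ht⟩
        · exact Or.inr (Or.inr (Or.inr (Or.inr ⟨x, y, z, t, hx, hy, hz, ht⟩)))
      · obtain ⟨t, ht⟩ := hsq l hkl.symm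
        exact Or.inr (Or.inr (Or.inr (Or.inl ⟨x, y, z, t, hx, hy, hz, ht⟩)))
    · obtain ⟨z, hz⟩ := hsq k hjk.symm
      obtain ⟨t, ht⟩ := hsq l hjl.symm
      exact Or.inr (Or.inr (Or.inl ⟨x, y, z, t, hx, hy, hz, ht⟩))
  · obtain ⟨y, hy⟩ := hsq j hij.symm
    obtain ⟨z, hz⟩ := hsq k hik.symm
    obtain ⟨t, ht⟩ := hsq l hil.symm
    exact Or.inr (Or.inl ⟨x, y, z, t, hx, hy, hz, ht⟩)

/-- No point of the curve with `y ≠ 0` has the square classes of the point `(0, 0)`. -/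
theorem false_of_squareClass_zero {p : ℕ} {a b : ℤ} {w : Fin 6 → ℤ} (hab : IsCoprime a b)
    (ha0 : a ≠ 0) (hw : ∃ c, ∀ i, ∃ z, z ≠ 0 ∧ (w i = z ^ 2 ∨ i = c ∧ w i = p * z ^ 2))
    (e0 : b = w 0) (e1 : a = w 1) (e2 : a - b = -w 2) (e3 : a + b = w 3)
    (e4 : a - 2 * b = -2 * w 4) (e5 : a + 2 * b = 2 * w 5) : False := by
  obtain ⟨c, hc⟩ := hw
  have hsq : ∀ i, i ≠ c → ∃ z, w i = z ^ 2 := fun i hi => by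
    obtain ⟨z, -, h | ⟨h, -⟩⟩ := hc i
    · exact ⟨z, h⟩
    · exact (hi h).elim
  have hae : Even a := ⟨b - w 4, by linarith⟩
  have hsr : c ≠ 0 → c ≠ 1 → ∃ s r, b = s ^ 2 ∧ a = r ^ 2 ∧ r ≠ 0 ∧ Even r ∧ IsCoprime s r := by
    intro hc0 hc1
    obtain ⟨s, hs⟩ := hsq 0 hc0.symm
    obtain ⟨r, hr⟩ := hsq 1 hc1.symm
    rw [hs] at e0
    rw [hr] at e1
    refine ⟨s, r, e0, e1, ?_, ?_, ?_⟩
    · rintro rfl; exact ha0 (by rw [e1]; norm_num)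
    · rw [e1] at hae; exact (Int.even_pow.1 hae).1
    · rw [e0, e1] at hab; exact ((IsCoprime.pow_iff two_pos two_pos).1 hab).symm
  by_cases h23 : c ≠ 2 ∧ c ≠ 3
  · obtain ⟨x, hx⟩ := hsq 2 h23.1.symm
    obtain ⟨y, hy⟩ := hsq 3 h23.2.symm
    rw [hx] at e2
    rw [hy] at e3
    by_cases h45 : c ≠ 4 ∧ c ≠ 5
    · obtain ⟨z, hz⟩ := hsq 4 h45.1.symm
      obtain ⟨t, ht⟩ := hsq 5 h45.2.symm
      rw [hz] at e4
      rw [ht] at e5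
      obtain ⟨α, rfl⟩ := hae
      have hα : α ≠ 0 := by rintro rfl; simp at ha0
      rw [← two_mul] at hab
      have h1 : (2 * b) ^ 2 - (α + α) ^ 2 = 4 * (z * t) ^ 2 := by
        linear_combination (-2 * b - (α + α)) * e4 + 2 * z ^ 2 * e5
      exact Int.one_four_descent (d := z * t) (c := x * y) hα hab.of_mul_left_right (by linarith)
        (by linear_combination (-b - 2 * α) * e2 + x ^ 2 * e3)
    · obtain ⟨s, r, hs, hr, hr0, hre, hc'⟩ := hsr (by rintro rfl; exact h45 (by decide))
        (by rintro rfl; exact h45 (by decide))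
      refine Int.pow_four_sub_pow_four_ne_sq (q := x * y) hr0 hre hc' ?_
      have : b ^ 2 - a ^ 2 = (x * y) ^ 2 := by linear_combination (-b - a) * e2 + x ^ 2 * e3
      rw [hs, hr] at this
      linarith
  · have h45 : c ≠ 4 ∧ c ≠ 5 ∧ c ≠ 0 ∧ c ≠ 1 := by
      refine ⟨?_, ?_, ?_, ?_⟩ <;> rintro rfl <;> exact h23 (by decide)
    obtain ⟨z, hz⟩ := hsq 4 h45.1.symm
    obtain ⟨t, ht⟩ := hsq 5 h45.2.1.symm
    rw [hz] at e4
    rw [ht] at e5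
    obtain ⟨s, r, hs, hr, hr0, hre, hc'⟩ := hsr h45.2.2.1 h45.2.2.2
    obtain ⟨ρ, rfl⟩ := hre
    have hρ : ρ ≠ 0 := by rintro rfl; simp at hr0
    have h1 : (2 * b) ^ 2 - a ^ 2 = 4 * (z * t) ^ 2 := by
      linear_combination (-2 * b - a) * e4 + 2 * z ^ 2 * e5
    rw [hs, hr] at h1
    have h2 : s ^ 4 = (z * t) ^ 2 + 4 * ρ ^ 4 := by linarith
    refine Int.pow_four_ne_sq_add_four_mul_pow_four hρ ?_ h2
    have h3 : IsCoprime ((z * t) ^ 2) (2 * ρ) :=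
      (hc'.pow (m := 4) (n := 4)).of_lin_comb 1 (2 * ρ ^ 3) 0 ((2 * ρ) ^ 3)
        (by rw [h2]; ring) (by ring)
    exact (IsCoprime.pow_left_iff two_pos).1 h3

theorem false_of_prod_linearForms {p : ℕ} [Fact p.Prime] (hp24 : p % 24 = 1)
    (h3 : ¬∃ w : ZMod p, w ^ 4 - 2 * w ^ 2 - 2 = 0) {a b Y : ℤ} (hab : IsCoprime a b) (hb : 0 < b)
    (h0 : ∀ i, linearForms a b i ≠ 0) (h : p * ∏ i, linearForms a b i = Y ^ 2) : False := by
  have hp : p.Prime := Fact.out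
  have hp0 : (0 : ℤ) < p := by exact_mod_cast hp.pos
  obtain ⟨d, w, hd, e, hw, hQ, h2', h3'⟩ := exists_squareClass_linearForms hp
    (by rintro rfl; norm_num at hp24) (by rintro rfl; norm_num at hp24) hab h0 h
  have hprod : 0 < ∏ i, linearForms a b i := by
    have hne : p * ∏ i, linearForms a b i ≠ 0 :=
      mul_ne_zero hp0.ne' (Finset.prod_ne_zero_iff.2 fun i _ => h0 i)
    rw [h] at hne
    refine (mul_pos_iff_of_pos_left hp0).1 ?_
    rw [h]
    exact lt_of_le_of_ne (sq_nonneg Y) hne.symm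
  have hwpos : ∀ i, 0 < w i := fun i => by
    obtain ⟨c, hc⟩ := hw
    obtain ⟨z, hz, h | ⟨-, h⟩⟩ := hc i <;> rw [h] <;> positivity
  have hwmod : ∀ i, w i % 8 = 1 ∨ w i % 32 = 4 ∨ w i % 16 = 0 := fun i => by
    obtain ⟨c, hc⟩ := hw
    obtain ⟨z, hz, h | ⟨-, h⟩⟩ := hc i
    · exact Int.emod_of_eq_sq h
    · exact Int.emod_of_eq_mul_sq (by omega) h
  rcases squareClass_linearForms hab hb hprod hd e hwpos hwmod hQ h2' h3' with
    rfl | rfl | rfl | rfl | rfl | rfl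
  all_goals
    have e0 := e 0
    have e1 := e 1
    have e2 := e 2
    have e3 := e 3
    have e4 := e 4
    have e5 := e 5
    simp only [linearForms, Matrix.cons_val] at e0 e1 e2 e3 e4 e5
  · exact SquaresUpToTwist.false_of_one_three h3 hp24
      (.of_forall hw (i := 2) (j := 0) (k := 1) (l := 5)
        (by decide) (by decide) (by decide) (by decide) (by decide) (by decide)) (hwpos 0).ne'
      (hab.of_lin_comb 1 1 0 1 (by linarith) (by linarith)) (by linarith) (by linarith)
  · exact false_of_squareClass_zero hab (h0 1) hw (by linarith) (by linarith) (by linarith)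
      (by linarith) (by linarith) (by linarith)
  · exact SquaresUpToTwist.false_of_one_three h3 hp24
      (.of_forall hw (i := 3) (j := 2) (k := 5) (l := 0)
        (by decide) (by decide) (by decide) (by decide) (by decide) (by decide)) (hwpos 2).ne'
      (hab.of_lin_comb 1 (-3) 1 3 (by linarith) (by linarith)) (by linarith) (by linarith)
  · exact SquaresUpToTwist.false_of_two_three h3 hp24
      (.of_forall hw (i := 0) (j := 3) (k := 4) (l := 2)
        (by decide) (by decide) (by decide) (by decide) (by decide) (by decide)) (hwpos 3).ne'
      (hab.of_lin_comb (-1) (-6) 1 0 (by linarith) (by linarith)) (by linarith) (by linarith)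
  · exact SquaresUpToTwist.false_of_two_three h3 hp24
      (.of_forall hw (i := 0) (j := 4) (k := 3) (l := 1)
        (by decide) (by decide) (by decide) (by decide) (by decide) (by decide)) (hwpos 4).ne'
      (hab.of_lin_comb 2 6 1 0 (by linarith) (by linarith)) (by linarith) (by linarith)
  · exact SquaresUpToTwist.false_of_one_three h3 hp24
      (.of_forall hw (i := 1) (j := 5) (k := 2) (l := 0)
        (by decide) (by decide) (by decide) (by decide) (by decide) (by decide)) (hwpos 5).ne'
      (hab.of_lin_comb (-2) 0 1 3 (by linarith) (by linarith)) (by linarith) (by linarith)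

/-- For a prime `p ≡ 25 (mod 48)` such that `2` is not a fourth power mod `p` and
`X⁴ − 2X² − 2` has no root mod `p` (i.e. `p` splits completely in neither `ℚ(2^{1/4})`
nor `ℚ(√(1+√3))`), every rational point on `C_p : y² = x(x² − p²)(x² − 4p²)` has `y = 0`. -/
theorem rational_points_Cp_of_twentyfive_mod_48_case_c (p : ℕ) (hp : Nat.Prime p)
    (hmod : p % 48 = 25)
    (h2 : ¬∃ z : ZMod p, z ^ 4 = 2)
    (h3 : ¬∃ w : ZMod p, w ^ 4 - 2 * w ^ 2 - 2 = 0)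
    (x y : ℚ) (h : y ^ 2 = x * (x ^ 2 - (p : ℚ) ^ 2) * (x ^ 2 - 4 * (p : ℚ) ^ 2)) :
    y = 0 ∧ (x = 0 ∨ x = p ∨ x = -p ∨ x = 2 * p ∨ x = -(2 * p)) := by
  have hy : y = 0 := by
    by_contra hy
    have : Fact p.Prime := ⟨hp⟩
    have hp0 : (p : ℚ) ≠ 0 := by exact_mod_cast hp.ne_zero
    obtain ⟨t, rfl⟩ : ∃ t : ℚ, x = p * t := ⟨x / p, by field_simp⟩
    have hb0 : (t.den : ℚ) ≠ 0 := by exact_mod_cast t.den_ne_zero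
    have hab : IsCoprime t.num (t.den : ℤ) := Int.isCoprime_iff_gcd_eq_one.2 t.reduced
    have ht : t * t.den = t.num := Rat.mul_den_eq_num t
    have hprod : ((p * ∏ i, linearForms t.num t.den i : ℤ) : ℚ) =
        (y * t.den ^ 3 / p ^ 2) * (y * t.den ^ 3 / p ^ 2) := by
      have hlhs : ∏ i, linearForms t.num t.den i = t.den * t.num * (t.num - t.den) *
          (t.num + t.den) * (t.num - 2 * t.den) * (t.num + 2 * t.den) := by
        simp [Fin.prod_univ_six, linearForms]
      rw [hlhs]
      push_cast
      rw [← ht]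
      field_simp
      rw [h]
      ring
    have hne : (p * ∏ i, linearForms t.num t.den i : ℤ) ≠ 0 := by
      intro h0
      rw [h0, Int.cast_zero] at hprod
      have := mul_self_eq_zero.1 hprod.symm
      have h' : y * (t.den : ℚ) ^ 3 / (p : ℚ) ^ 2 ≠ 0 := by positivity
      exact h' this
    obtain ⟨Y, hY⟩ := Rat.isSquare_intCast_iff.1 ⟨_, hprod⟩
    exact false_of_prod_linearForms (by omega) h3 hab (by exact_mod_cast t.den_pos)
      (fun i => Finset.prod_ne_zero_iff.1 (right_ne_zero_of_mul hne) i (Finset.mem_univ i))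
      (hY.trans (pow_two Y).symm)
  refine ⟨hy, ?_⟩
  rw [hy] at h
  have h' : x * ((x - p) * (x + p)) * ((x - 2 * p) * (x + 2 * p)) = 0 := by linear_combination -h
  simp only [mul_eq_zero, sub_eq_zero, add_eq_zero_iff_eq_neg] at h'
  tauto
end

section
/- For any odd prime p, the class number of the quadratic field ℚ(√p*) is odd, where p* = (−1)^{(p−1)/2}·p (so p* = p if p ≡ 1 (mod 4) and p* = −p if p ≡ 3 (mod 4)). -/
/-- Let `ω = (1 + √d) / 2` with `d` a prime integer. An ideal of `ℤ[ω]` that is stable under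
conjugation is principal. -/
theorem Ideal.isPrincipal_of_map_conj_eq {R : Type*} [CommRing R] [IsDedekindDomain R] [CharZero R]
    (σ : R ≃+* R) {k : ℤ} (hk : Prime (1 + 4 * k)) {ω : R} (hω2 : ω ^ 2 = ω + k)
    (hσω : σ ω = 1 - ω) (hspan : ∀ x : R, ∃ c b : ℤ, x = c + b * ω)
    (I : Ideal R) (hI : I.map σ = I) : I.IsPrincipal := by
  have h2 : (2 : R) ≠ 0 := two_ne_zero
  obtain ⟨d, hdk⟩ : ∃ d, d = 1 + 4 * k := ⟨_, rfl⟩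
  have hdk' : (d : R) = 1 + 4 * k := by exact_mod_cast hdk
  have hd : Prime d := hdk ▸ hk
  obtain ⟨α, hω⟩ : ∃ α, 2 * ω = 1 + α := ⟨2 * ω - 1, by ring⟩
  have hα : α ^ 2 = d := by
    linear_combination (-2 * ω - α + 1) * hω + 4 * hω2 - hdk'
  have hσ : σ α = -α := by
    have := congrArg σ hω
    simp only [map_mul, map_add, map_one, map_ofNat, hσω] at this
    linear_combination -this - hω
  have hα0 : α ≠ 0 := by
    rintro rfl
    rw [zero_pow two_ne_zero, eq_comm, Int.cast_eq_zero] at hα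
    exact hd.ne_zero hα
  have hαu : ¬ IsUnit α := by
    intro h
    have h1 : IsUnit (d : R) := hα ▸ h.pow 2
    obtain ⟨y, hy⟩ := h1.exists_right_inv
    have hN := congrArg (fun z => z * σ z) hy
    obtain ⟨c, b, rfl⟩ := hspan y
    simp only [map_mul, map_add, map_one, map_intCast, hσω] at hN
    have hd1 : ((d * (d * (c ^ 2 + c * b - k * b ^ 2)) : ℤ) : R) = ((1 : ℤ) : R) := by
      push_cast
      linear_combination hN + d ^ 2 * b ^ 2 * hω2
    exact hd.not_isUnit (IsUnit.of_mul_eq_one _ (Int.cast_injective hd1))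
  induction I using IsNoetherian.induction with
  | hgt I ih =>
  change Ideal R at I
  rcases eq_or_ne I ⊥ with rfl | hI0
  · infer_instance
  have hmem : ∀ x ∈ I, σ x ∈ I := fun x hx => hI ▸ Ideal.mem_map_of_mem σ hx
  obtain ⟨m, hm⟩ := (IsPrincipalIdealRing.principal (Ideal.comap (Int.castRingHom R) I)).principal
  have hmI : ∀ n : ℤ, (n : R) ∈ I ↔ m ∣ n := fun n => by
    rw [← Ideal.mem_span_singleton, ← Ideal.submodule_span_eq, ← hm, Ideal.mem_comap]
    rfl
  by_cases hdm : d ∣ m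
  · have hle : I ≤ Ideal.span {α} := by
      intro x hx
      obtain ⟨c, b, rfl⟩ := hspan x
      have hN : ((c ^ 2 + c * b - k * b ^ 2 : ℤ) : R) ∈ I := by
        have := I.mul_mem_right (σ (c + b * ω)) hx
        convert this using 1
        simp only [map_mul, map_add, map_intCast, hσω]
        push_cast
        linear_combination b ^ 2 * hω2
      have hdN : d ∣ c ^ 2 + c * b - k * b ^ 2 := hdm.trans ((hmI _).1 hN)
      have : d ∣ (2 * c + b) ^ 2 := by
        have h : (2 * c + b) ^ 2 = 4 * (c ^ 2 + c * b - k * b ^ 2) + d * b ^ 2 := by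
          rw [hdk]; ring
        rw [h]
        exact dvd_add (hdN.mul_left _) (dvd_mul_right _ _)
      obtain ⟨a, ha⟩ := hd.dvd_of_dvd_pow this
      rw [Ideal.mem_span_singleton]
      refine ⟨2 * k * a - c + a * ω, mul_left_cancel₀ h2 ?_⟩
      have ha' : (2 * c + b : R) = d * a := by exact_mod_cast ha
      linear_combination (b - α * a) * hω - a * hα + (1 + α) * ha' + α * a * hdk'
    obtain ⟨J, rfl⟩ := Ideal.dvd_iff_le.2 hle
    have hα0' : Ideal.span {α} ≠ ⊥ := by simpa using hα0
    have hJ0 : J ≠ ⊥ := by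
      rintro rfl
      simp at hI0
    have hJ : J.map σ = J := by
      apply mul_left_cancel₀ hα0'
      conv_rhs => rw [← hI]
      rw [Ideal.map_mul, Ideal.map_span, Set.image_singleton, hσ, Ideal.span_singleton_neg]
    have hlt : Ideal.span {α} * J < J := by
      refine lt_of_le_of_ne Ideal.mul_le_right fun h => hαu ?_
      rw [← Ideal.span_singleton_eq_top, ← Ideal.one_eq_top]
      exact mul_right_cancel₀ hJ0 (by rw [h, one_mul])
    obtain ⟨y, rfl⟩ := (ih J hlt hJ).principal
    exact ⟨α * y, by simp [Ideal.span_singleton_mul_span_singleton]⟩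
  · have hcop : IsCoprime m d := ((Prime.coprime_iff_not_dvd hd).2 hdm).symm
    refine ⟨(m : R), le_antisymm (fun x hx => ?_) ?_⟩
    · obtain ⟨c, b, rfl⟩ := hspan x
      have hbI : (b : R) ∈ I := by
        rw [hmI]
        refine hcop.dvd_of_dvd_mul_right ((hmI _).1 ?_)
        have := I.mul_mem_left α (I.sub_mem hx (hmem _ hx))
        convert this using 1
        simp only [map_mul, map_add, map_intCast, hσω]
        push_cast
        linear_combination -b * hα - b * α * hω
      have hcI : (c : R) ∈ I := by
        simpa using I.sub_mem hx (I.mul_mem_right ω hbI)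
      rw [hmI] at hbI hcI
      rw [Ideal.submodule_span_eq, Ideal.mem_span_singleton]
      exact dvd_add (Int.cast_dvd_cast _ _ hcI) ((Int.cast_dvd_cast _ _ hbI).mul_right _)
    · rw [Ideal.submodule_span_eq, Ideal.span_singleton_le_iff_mem, hmI]

/-- If every ideal stable under an involution is principal, and elements generating the same norm
ideal can be rescaled by a unit to have the same norm, then an ideal whose square is principal is
itself principal. -/
theorem Ideal.isPrincipal_of_sq_isPrincipal_of_involutive {R : Type*} [CommRing R]
    [IsDedekindDomain R] (σ : R ≃+* R) (hσ : ∀ x, σ (σ x) = x)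
    (hprin : ∀ I : Ideal R, I.map σ = I → I.IsPrincipal)
    (hnorm : ∀ x y : R, Associated (x * σ x) (y * σ y) →
      ∃ v : Rˣ, (v * x) * σ (v * x) = y * σ y)
    (I : Ideal R) (hI : (I ^ 2).IsPrincipal) : I.IsPrincipal := by
  rcases eq_or_ne I ⊥ with rfl | hI0
  · infer_instance
  have hσσ (J : Ideal R) : (J.map σ).map σ = J := by
    refine le_antisymm ?_ fun x hx => ?_
    · rw [Ideal.map_le_iff_le_comap, Ideal.map_le_iff_le_comap]
      intro x hx
      rwa [Ideal.mem_comap, Ideal.mem_comap, hσ]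
    · rw [← hσ x]
      exact Ideal.mem_map_of_mem σ (Ideal.mem_map_of_mem σ hx)
  have hσI0 : I.map σ ≠ ⊥ := by
    intro h
    apply hI0
    rw [← hσσ I, h, Ideal.map_bot]
  have hspan (x : R) : (Ideal.span {x}).map σ = Ideal.span {σ x} := by
    rw [Ideal.map_span, Set.image_singleton]
  obtain ⟨g, hg⟩ := hI.principal
  obtain ⟨δ, hδ⟩ := (hprin (I * I.map σ) (by rw [Ideal.map_mul, hσσ, mul_comm])).principal
  rw [Ideal.submodule_span_eq] at hg hδ
  have hg0 : g ≠ 0 := by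
    rintro rfl
    rw [Ideal.span_singleton_zero] at hg
    exact pow_ne_zero 2 hI0 hg
  have hσg0 : σ g ≠ 0 := by simpa using hg0
  have key : Ideal.span {δ} * I = Ideal.span {g} * I.map σ := by
    rw [← hg, ← hδ]; ring
  have key' : Ideal.span {σ δ} * I.map σ = Ideal.span {σ g} * I := by
    have := congrArg (Ideal.map σ) key
    rwa [Ideal.map_mul, Ideal.map_mul, hσσ, hspan, hspan] at this
  have hass : Associated (δ * σ δ) (g * σ g) := by
    rw [← Ideal.span_singleton_eq_span_singleton, ← Ideal.span_singleton_mul_span_singleton,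
      ← Ideal.span_singleton_mul_span_singleton]
    apply mul_right_cancel₀ (mul_ne_zero hI0 hσI0)
    calc _ = (Ideal.span {δ} * I) * (Ideal.span {σ δ} * I.map σ) := by ring
      _ = _ := by rw [key, key']; ring
  obtain ⟨v, hv⟩ := hnorm δ g hass
  have hvδ : Ideal.span {v * δ} = Ideal.span {δ} := by
    rw [Ideal.span_singleton_eq_span_singleton]
    exact associated_unit_mul_left _ _ v.isUnit
  rw [← hvδ] at key
  generalize (v : R) * δ = ε at hv key
  by_cases hε : ε = -g
  · apply hprin
    rw [hε, Ideal.span_singleton_neg] at key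
    exact (mul_left_cancel₀ (by simpa using hg0) key).symm
  -- Hilbert 90: `β` satisfies `σ β / β = g / ε`
  set β := (g + ε) * σ g with hβ
  have hβ0 : β ≠ 0 := mul_ne_zero (fun h => hε (by linear_combination h)) hσg0
  have hε0 : ε ≠ 0 := by
    rintro rfl
    rw [zero_mul] at hv
    exact mul_ne_zero hg0 hσg0 hv.symm
  have hσβ : ε * σ β = g * β := by
    rw [hβ, map_mul, map_add, hσ]
    linear_combination g * hv
  have hprin' : (Ideal.span {β} * I).IsPrincipal := by
    apply hprin
    rw [Ideal.map_mul, hspan]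
    have h0 : Ideal.span {g} * Ideal.span {ε} ≠ ⊥ := by
      rw [Ideal.span_singleton_mul_span_singleton]
      simpa using ⟨hg0, hε0⟩
    apply mul_left_cancel₀ h0
    calc _ = (Ideal.span {ε} * Ideal.span {σ β}) * (Ideal.span {g} * I.map σ) := by ring
      _ = (Ideal.span {g} * Ideal.span {β}) * (Ideal.span {ε} * I) := by
        rw [key, Ideal.span_singleton_mul_span_singleton, hσβ,
          Ideal.span_singleton_mul_span_singleton]
      _ = _ := by ring
  obtain ⟨z, hz⟩ := hprin'.principal
  rw [Ideal.submodule_span_eq] at hz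
  have hzβ : z ∈ Ideal.span {β} := by
    rw [← Ideal.span_singleton_le_iff_mem, ← hz]
    exact Ideal.mul_le_left
  obtain ⟨w, rfl⟩ := Ideal.mem_span_singleton.1 hzβ
  refine ⟨w, mul_left_cancel₀ (a := Ideal.span {β}) (by simpa using hβ0) ?_⟩
  rw [hz, Ideal.submodule_span_eq, Ideal.span_singleton_mul_span_singleton]

/-- The negative Pell equation is solvable for primes congruent to `1` modulo `4`. -/
theorem Pell.exists_sq_sub_mul_sq_eq_neg_one {p : ℕ} (hp : p.Prime) (hp4 : p % 4 = 1) :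
    ∃ x y : ℤ, x ^ 2 - p * y ^ 2 = -1 := by
  have hpZ : Prime (p : ℤ) := Nat.prime_iff_prime_int.1 hp
  have hp0 : (0 : ℤ) < p := by exact_mod_cast hp.pos
  obtain ⟨a, h1, hy, hmin⟩ :=
    Pell.IsFundamental.exists_of_not_isSquare hp0 hpZ.irreducible.not_isSquare
  have hprop := a.prop
  generalize a.x = x at *
  generalize a.y = y at *
  have hp4' : (p : ℤ) % 4 = 1 := by exact_mod_cast hp4
  obtain ⟨k, hk⟩ : ∃ k : ℤ, (p : ℤ) = 1 + 4 * k := ⟨p / 4, by omega⟩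
  have hyeven : Even y := by
    by_contra h
    rw [Int.not_even_iff_odd] at h
    obtain ⟨t, rfl⟩ := h
    rcases Int.even_or_odd x with ⟨s, rfl⟩ | ⟨s, rfl⟩
    · have : 4 * (s ^ 2 - p * (t ^ 2 + t) - k) = 2 := by linear_combination hprop + hk
      omega
    · have : 4 * (s ^ 2 + s - p * (t ^ 2 + t) - k) = 1 := by linear_combination hprop + hk
      omega
  obtain ⟨t, rfl⟩ := hyeven
  have hxodd : Odd x := by
    by_contra h
    rw [Int.not_odd_iff_even] at h
    obtain ⟨s, rfl⟩ := h
    have : 4 * (s ^ 2 - p * t ^ 2) = 1 := by linear_combination hprop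
    omega
  obtain ⟨s, rfl⟩ := hxodd
  have hst : s * (s + 1) = p * t ^ 2 := by linarith
  have hs0 : 0 < s := by omega
  have ht0 : 0 < t := by omega
  have hcop : IsCoprime s (s + 1) := ⟨-1, 1, by ring⟩
  rcases hpZ.dvd_or_dvd ⟨t ^ 2, hst⟩ with ⟨r, hr⟩ | ⟨r, hr⟩
  · exfalso
    have hrt : (s + 1) * r = t ^ 2 := by
      apply mul_left_cancel₀ hpZ.ne_zero
      rw [← hst, hr]; ring
    have hcop' : IsCoprime (s + 1) r := by
      rw [hr] at hcop ⊢
      exact hcop.of_mul_left_right.symm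
    have hr0 : 0 < r := pos_of_mul_pos_right (hr ▸ hs0) hp0.le
    obtain ⟨b, hb⟩ := Int.sq_of_isCoprime hcop' hrt
    obtain ⟨c, hc⟩ := Int.sq_of_isCoprime hcop'.symm (mul_comm r _ ▸ hrt)
    replace hb := hb.resolve_right (by have := sq_nonneg b; omega)
    replace hc := hc.resolve_right (by have := sq_nonneg c; omega)
    have hb1 : 1 < |b| := by
      rw [← one_lt_sq_iff_one_lt_abs]; omega
    have hle := hmin (b := .mk |b| c (by rw [sq_abs, ← hb, ← hc, ← hr]; ring)) hb1
    rw [Pell.Solution₁.x_mk] at hle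
    have := sq_abs b
    nlinarith
  · have hrt : s * r = t ^ 2 := by
      apply mul_left_cancel₀ hpZ.ne_zero
      rw [← hst, hr]; ring
    have hcop' : IsCoprime s r := by
      rw [hr] at hcop
      exact hcop.of_mul_right_right
    have hr0 : 0 < r := pos_of_mul_pos_right (hr ▸ (by omega : 0 < s + 1)) hp0.le
    obtain ⟨b, hb⟩ := Int.sq_of_isCoprime hcop' hrt
    obtain ⟨c, hc⟩ := Int.sq_of_isCoprime hcop'.symm (mul_comm r _ ▸ hrt)
    replace hb := hb.resolve_right (by have := sq_nonneg b; omega)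
    replace hc := hc.resolve_right (by have := sq_nonneg c; omega)
    exact ⟨b, c, by rw [← hb, ← hc, ← hr]; ring⟩

/-- Let `ω = (1 + √d) / 2` with `d` a prime integer, and suppose `ℤ[ω]` contains an element of norm
`-1` if `d` is positive. An ideal of `ℤ[ω]` whose square is principal is itself principal. -/
theorem Ideal.isPrincipal_of_sq_isPrincipal_of_prime {R : Type*} [CommRing R] [IsDedekindDomain R]
    [CharZero R] (σ : R ≃+* R) {k : ℤ} (hk : Prime (1 + 4 * k)) {ω : R} (hω2 : ω ^ 2 = ω + k)
    (hσω : σ ω = 1 - ω) (hspan : ∀ x : R, ∃ c b : ℤ, x = c + b * ω)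
    (hneg : 0 < k → ∃ v : R, v * σ v = -1)
    (I : Ideal R) (hI : (I ^ 2).IsPrincipal) : I.IsPrincipal := by
  have hnorm (x : R) : ∃ n : ℤ, x * σ x = n ∧ (k < 0 → 0 ≤ n) := by
    obtain ⟨c, b, rfl⟩ := hspan x
    refine ⟨c ^ 2 + c * b - k * b ^ 2, ?_, fun h => ?_⟩
    · simp only [map_mul, map_add, map_intCast, hσω]
      push_cast
      linear_combination -b ^ 2 * hω2
    · nlinarith [sq_nonneg (2 * c + b), sq_nonneg b]
  have hσ (x : R) : σ (σ x) = x := by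
    obtain ⟨c, b, rfl⟩ := hspan x
    simp [hσω]
  have hdvd {n m : ℤ} (h : (n : R) ∣ m) : n ∣ m := by
    obtain ⟨u, hu⟩ := h
    obtain ⟨c, hc, -⟩ := hnorm u
    rw [← Int.pow_dvd_pow_iff two_ne_zero]
    refine ⟨c, Int.cast_injective (α := R) ?_⟩
    have := congrArg σ hu
    rw [map_mul, map_intCast, map_intCast] at this
    push_cast
    rw [← hc]
    linear_combination m * hu + n * u * this
  refine Ideal.isPrincipal_of_sq_isPrincipal_of_involutive σ hσ
    (Ideal.isPrincipal_of_map_conj_eq σ hk hω2 hσω hspan) (fun x y hxy => ?_) I hI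
  obtain ⟨n, hn, hn0⟩ := hnorm x
  obtain ⟨m, hm, hm0⟩ := hnorm y
  rw [hn, hm] at hxy
  rcases Int.natAbs_eq_natAbs_iff.1
    (Int.natAbs_eq_of_dvd_dvd (hdvd hxy.dvd) (hdvd hxy.symm.dvd)) with rfl | rfl
  · exact ⟨1, by simp [hn, hm]⟩
  rcases lt_trichotomy k 0 with hk0 | rfl | hk0
  · have : m = 0 := by linarith [hn0 hk0, hm0 hk0]
    subst this
    exact ⟨1, by simp [hn, hm]⟩
  · simp at hk
  · obtain ⟨v, hv⟩ := hneg hk0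
    refine ⟨⟨v, -σ v, by linear_combination -hv, by linear_combination -hv⟩, ?_⟩
    rw [map_mul, hm]
    push_cast at hn
    linear_combination x * σ x * hv - hn

open NumberField

/-- The ring of integers of `ℚ(√d)`, with `d = 1 + 4 * k` prime, is `ℤ[(1 + √d) / 2]`. -/
theorem NumberField.exists_conj_of_finrank_eq_two {K : Type*} [Field K] [NumberField K]
    (hK : Module.finrank ℚ K = 2) {k : ℤ} (hk : Prime (1 + 4 * k)) {α : K}
    (hα : α ^ 2 = ((1 + 4 * k : ℤ) : K)) :
    ∃ (σ : 𝓞 K ≃+* 𝓞 K) (ω : 𝓞 K), ω ^ 2 = ω + k ∧ σ ω = 1 - ω ∧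
      ∀ x : 𝓞 K, ∃ c b : ℤ, x = c + b * ω := by
  have : Algebra.IsQuadraticExtension ℚ K := ⟨hK⟩
  obtain ⟨d, hdk⟩ : ∃ d, d = 1 + 4 * k := ⟨_, rfl⟩
  rw [← hdk] at hk hα
  have hdk' : (d : K) = 1 + 4 * k := by exact_mod_cast hdk
  have h2 : (2 : K) ≠ 0 := two_ne_zero
  have hcard : Nat.card Gal(K/ℚ) = 2 := by rw [IsGalois.card_aut_eq_finrank, hK]
  obtain ⟨τ, hτ1, hτ⟩ : ∃ τ : Gal(K/ℚ), τ ≠ 1 ∧ ∀ f, f = 1 ∨ f = τ := by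
    obtain ⟨τ, h, hu⟩ := (Nat.card_eq_two_iff' (1 : Gal(K/ℚ))).1 hcard
    exact ⟨τ, h, fun f => or_iff_not_imp_left.2 (hu f)⟩
  have hττ (x : K) : τ (τ x) = x := by
    rcases hτ (τ * τ) with h | h
    · exact DFunLike.congr_fun h x
    · exact absurd (mul_eq_left.1 h) hτ1
  have hfix (x : K) (hx : τ x = x) (hint : IsIntegral ℤ x) : ∃ n : ℤ, x = n := by
    obtain ⟨q, rfl⟩ : x ∈ Set.range (algebraMap ℚ K) := by
      rw [IsGalois.mem_range_algebraMap_iff_fixed]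
      intro f
      rcases hτ f with rfl | rfl
      · rfl
      · exact hx
    rw [isIntegral_algebraMap_iff (algebraMap ℚ K).injective] at hint
    obtain ⟨n, rfl⟩ := IsIntegrallyClosed.isIntegral_iff.1 hint
    exact ⟨n, by simp⟩
  have hαint : IsIntegral ℤ α := by
    refine IsIntegral.of_pow two_pos ?_
    rw [hα]
    exact isIntegral_algebraMap (x := d)
  have hτα : τ α = -α := by
    have h : (τ α) ^ 2 = α ^ 2 := by rw [← map_pow, hα, map_intCast]
    refine (sq_eq_sq_iff_eq_or_eq_neg.1 h).resolve_left fun h => ?_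
    obtain ⟨n, rfl⟩ := hfix α h hαint
    exact hk.irreducible.not_isSquare ⟨n, by rw [← sq]; exact_mod_cast hα.symm⟩
  have hα0 : α ≠ 0 := by
    rintro rfl
    rw [zero_pow two_ne_zero, eq_comm, Int.cast_eq_zero] at hα
    exact hk.ne_zero hα
  obtain ⟨w, hw⟩ : ∃ w, 2 * w = 1 + α := ⟨(1 + α) / 2, by field_simp⟩
  have hw2 : w ^ 2 = w + k := by
    apply mul_left_cancel₀ h2
    apply mul_left_cancel₀ h2
    linear_combination (2 * w + α - 1) * hw + hα + hdk'
  have hwint : IsIntegral ℤ w := by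
    refine ⟨Polynomial.X ^ 2 - Polynomial.X - Polynomial.C k, ?_, ?_⟩
    · monicity!
    · rw [Polynomial.eval₂_sub, Polynomial.eval₂_sub, Polynomial.eval₂_X_pow, Polynomial.eval₂_X,
        Polynomial.eval₂_C, hw2]
      simp
  have hτw : τ w = 1 - w := by
    apply mul_left_cancel₀ h2
    have := congrArg τ hw
    simp only [map_mul, map_add, map_one, map_ofNat, hτα] at this
    linear_combination this + hw
  obtain ⟨ω, rfl⟩ : ∃ ω : 𝓞 K, (ω : K) = w := ⟨⟨w, hwint⟩, rfl⟩
  refine ⟨RingOfIntegers.mapRingEquiv (τ : K ≃+* K), ω, RingOfIntegers.ext ?_,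
    RingOfIntegers.ext ?_, fun x => ?_⟩
  · push_cast
    simpa using hw2
  · push_cast
    exact hτw
  have hx : IsIntegral ℤ (x : K) := x.isIntegral_coe
  have hτx : IsIntegral ℤ (τ x) := hx.map (τ.toAlgHom.restrictScalars ℤ)
  obtain ⟨a, ha⟩ := hfix (x + τ x) (by rw [map_add, hττ, add_comm]) (hx.add hτx)
  obtain ⟨n, hn⟩ := hfix (x * τ x) (by rw [map_mul, hττ, mul_comm]) (hx.mul hτx)
  obtain ⟨e, he⟩ := hfix (α * (x - τ x)) (by rw [map_mul, map_sub, hττ, hτα]; ring)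
    (hαint.mul (hx.sub hτx))
  have hde : d ∣ e := by
    refine hk.dvd_of_dvd_pow (n := 2) ⟨a ^ 2 - 4 * n, Int.cast_injective (α := K) ?_⟩
    push_cast
    rw [← he, ← ha, ← hn, ← hα]
    ring
  obtain ⟨b, rfl⟩ := hde
  have hb : x - τ x = α * b := by
    apply mul_left_cancel₀ hα0
    rw [he]
    push_cast
    linear_combination -b * hα
  have hab : a ^ 2 - d * b ^ 2 = 4 * n := Int.cast_injective (α := K) (by
    push_cast
    rw [← ha, ← hn, ← hα]
    linear_combination (x - τ x + α * b) * hb)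
  have hpar : Even (a - b) := by
    have h : Even (a ^ 2 - b ^ 2) := by
      rw [hdk] at hab
      exact ⟨2 * (n + k * b ^ 2), by linear_combination hab⟩
    simpa [Int.even_sub, Int.even_pow] using h
  obtain ⟨c, hc⟩ := hpar
  refine ⟨c, b, RingOfIntegers.ext (mul_left_cancel₀ h2 ?_)⟩
  have hc' : (a : K) - b = c + c := by exact_mod_cast hc
  have hcast : ((c + b * ω : 𝓞 K) : K) = c + b * ω := by simp
  rw [hcast]
  linear_combination ha + hb - b * hw + hc'

/-- For any odd prime `p`, the class number of the quadratic field `ℚ(√p*)` is odd, where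
`p* = (−1)^((p−1)/2) · p`. A number field `K` of degree `2` over `ℚ` containing a square
root of `p*` is precisely the quadratic field `ℚ(√p*)`. -/
theorem classNumber_odd_of_quadratic_sqrt_pstar (p : ℕ) (hp : Nat.Prime p) (hodd : Odd p)
    (K : Type) [Field K] [NumberField K] (hK : Module.finrank ℚ K = 2)
    (α : K) (hα : α ^ 2 = (-1 : K) ^ ((p - 1) / 2) * (p : K)) :
    Odd (NumberField.classNumber K) := by
  obtain ⟨k, hk, hkpos⟩ : ∃ k : ℤ, (-1) ^ ((p - 1) / 2) * (p : ℤ) = 1 + 4 * k ∧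
      (0 < k → p % 4 = 1 ∧ (p : ℤ) = 1 + 4 * k) := by
    rcases Nat.odd_mod_four_iff.1 (Nat.odd_iff.1 hodd) with h | h
    · refine ⟨p / 4, ?_, fun _ => by omega⟩
      rw [Even.neg_one_pow (by rw [Nat.even_iff]; omega)]
      omega
    · refine ⟨-(p / 4) - 1, ?_, fun _ => by omega⟩
      rw [Odd.neg_one_pow (by rw [Nat.odd_iff]; omega)]
      omega
  have hprime : Prime (1 + 4 * k) := by
    rw [← hk]
    refine (associated_unit_mul_left (p : ℤ) _ (isUnit_one.neg.pow _)).symm.prime ?_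
    exact Nat.prime_iff_prime_int.1 hp
  obtain ⟨σ, ω, hω2, hσω, hspan⟩ :=
    exists_conj_of_finrank_eq_two hK hprime (α := α) (by rw [hα, ← hk]; push_cast; rfl)
  have hneg (h : 0 < k) : ∃ v : 𝓞 K, v * σ v = -1 := by
    obtain ⟨hp4, hpk⟩ := hkpos h
    obtain ⟨x, y, hxy⟩ := Pell.exists_sq_sub_mul_sq_eq_neg_one hp hp4
    have hxy' : (x : 𝓞 K) ^ 2 - (1 + 4 * k) * y ^ 2 = -1 := by
      rw [hpk] at hxy
      exact_mod_cast congrArg (Int.cast (R := 𝓞 K)) hxy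
    refine ⟨x + y * (2 * ω - 1), ?_⟩
    simp only [map_mul, map_add, map_sub, map_one, map_ofNat, map_intCast, hσω]
    linear_combination hxy' - 4 * y ^ 2 * hω2
  rw [← Nat.not_even_iff_odd, even_iff_two_dvd]
  intro hdvd
  obtain ⟨C, hC⟩ := exists_prime_orderOf_dvd_card (G := ClassGroup (𝓞 K)) 2 hdvd
  obtain ⟨⟨I, hI0⟩, rfl⟩ := ClassGroup.mk0_surjective C
  have hsq : (I ^ 2).IsPrincipal := by
    rw [← ClassGroup.mk0_eq_one_iff (pow_mem hI0 2), ← SubmonoidClass.mk_pow I hI0, map_pow, ← hC,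
      pow_orderOf_eq_one]
  have hI := Ideal.isPrincipal_of_sq_isPrincipal_of_prime σ hprime hω2 hσω hspan hneg I hsq
  rw [(ClassGroup.mk0_eq_one_iff hI0).2 hI, orderOf_one] at hC
  exact absurd hC (by norm_num)
end
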